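/- arXiv:2108.06211 — 3 statements merged into one kernel-verified Lean document; each statement's English description precedes it below -/
import Mathlib

section
/- Suppose Assumptions A1–A3 hold. Then there exist a probability kernel π from F^ℕ to E and random variables F : Ω → (0,∞) and κ : Ω → (0,1) such that for every z ∈ E, ℙ-almost surely, for all n ≥ 1, d_TV(δ_z P_{X_{-n}} ⋯ P_{X_{-1}}, π_{ξ_{-1}}) ≤ F (1 + V(z)) κ^n, where ξ_{-1} = (X_{-1-j})_{j≥0}. In particular, the backward iterations δ_z P_{X_{-n}} ⋯ P_{X_{-1}} converge ℙ-almost surely in total variation, as n → ∞, to the random probability measure π_{ξ_{-1}}, which does not depend on z. -/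
open MeasureTheory ProbabilityTheory Filter
open scoped ENNReal

noncomputable section

/-- The shift operator on two-sided paths. -/
def zshift {α : Type*} (x : ℤ → α) : ℤ → α := fun t => x (t + 1)

/-- One step of the inhomogeneous chain: the pushforward of `μ` by the kernel `P_x`. -/
def stepMeas {E F : Type*} [MeasurableSpace E] [MeasurableSpace F]
    (P : Kernel (F × E) E) (x : F) (μ : Measure E) : Measure E :=
  μ.bind fun y => P (x, y)

/-- `iterFrom P [x₁, …, xₙ] μ = μ P_{x₁} ⋯ P_{xₙ}`: the law at the final time of the
inhomogeneous chain with initial law `μ` run through the kernels `P_{x₁}, …, P_{xₙ}`. -/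
def iterFrom {E F : Type*} [MeasurableSpace E] [MeasurableSpace F]
    (P : Kernel (F × E) E) : List F → Measure E → Measure E
  | [], μ => μ
  | x :: xs, μ => iterFrom P xs (stepMeas P x μ)

/-- The total variation distance between two measures. -/
def dTV {E : Type*} [MeasurableSpace E] (μ ν : Measure E) : ℝ≥0∞ :=
  ⨆ (A : Set E) (_ : MeasurableSet A), max (μ A - ν A) (ν A - μ A)

/-- Backward list: `bl s n = [s (n-1), …, s 0]`. -/
def bl {F : Type*} (s : ℕ → F) : ℕ → List F
  | 0 => []
  | n + 1 => s n :: bl s n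

/-- The function `y ↦ (δ_y P_{x₁} ⋯ P_{xₙ})(A)`. -/
def ef {E F : Type*} [MeasurableSpace E] [MeasurableSpace F]
    (P : Kernel (F × E) E) (A : Set E) : List F → E → ℝ≥0∞
  | [], y => A.indicator 1 y
  | x :: xs, y => ∫⁻ z, ef P A xs z ∂(P (x, y))

section kern

variable {E F : Type*} [MeasurableSpace E] [MeasurableSpace F]

lemma ef_measurable (P : Kernel (F × E) E) {A : Set E} (hA : MeasurableSet A) (xs : List F) :
    Measurable (ef P A xs) := by
  induction xs with
  | nil => exact (measurable_one.indicator hA)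
  | cons x xs ih =>
    have h := (ih.lintegral_kernel (κ := P)).comp (measurable_prodMk_left (x := x))
    exact h

lemma ef_le_one (P : Kernel (F × E) E) [IsMarkovKernel P] (A : Set E) (xs : List F) (y : E) :
    ef P A xs y ≤ 1 := by
  induction xs generalizing y with
  | nil =>
    by_cases h : y ∈ A <;> simp [ef, h]
  | cons x xs ih =>
    calc ef P A (x :: xs) y = ∫⁻ z, ef P A xs z ∂(P (x, y)) := rfl
      _ ≤ ∫⁻ z, 1 ∂(P (x, y)) := lintegral_mono ih
      _ = 1 := by simp

lemma iterFrom_apply (P : Kernel (F × E) E) {A : Set E} (hA : MeasurableSet A) (xs : List F)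
    (μ : Measure E) : iterFrom P xs μ A = ∫⁻ y, ef P A xs y ∂μ := by
  induction xs generalizing μ with
  | nil => simp [iterFrom, ef, lintegral_indicator_one hA]
  | cons x xs ih =>
    have hm : Measurable fun y => P (x, y) := P.measurable.comp measurable_prodMk_left
    rw [iterFrom, ih, stepMeas, Measure.lintegral_bind hm.aemeasurable
      (ef_measurable P hA xs).aemeasurable]
    rfl

lemma iterFrom_dirac (P : Kernel (F × E) E) {A : Set E} (hA : MeasurableSet A) (xs : List F)
    (y : E) : iterFrom P xs (Measure.dirac y) A = ef P A xs y := by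
  rw [iterFrom_apply P hA, lintegral_dirac' _ (ef_measurable P hA xs)]

lemma ef_univ (P : Kernel (F × E) E) [IsMarkovKernel P] (xs : List F) (y : E) :
    ef P Set.univ xs y = 1 := by
  induction xs generalizing y with
  | nil => simp [ef]
  | cons x xs ih => simp [ef, ih]

lemma ef_bl_measurable (P : Kernel (F × E) E) [IsMarkovKernel P] {A : Set E}
    (hA : MeasurableSet A) (n : ℕ) :
    Measurable (fun p : (ℕ → F) × E => ef P A (bl p.1 n) p.2) := by
  induction n with
  | zero => exact ((measurable_one.indicator hA).comp measurable_snd)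
  | succ n ih =>
    have hm : Measurable (fun p : (ℕ → F) × E => (p.1 n, p.2)) :=
      ((measurable_pi_apply n).comp measurable_fst).prodMk measurable_snd
    have := Measurable.lintegral_kernel_prod_right (κ := P.comap _ hm)
      (f := fun p z => ef P A (bl p.1 n) z)
      (ih.comp ((measurable_fst.comp measurable_fst).prodMk measurable_snd))
    simpa [bl, ef, Kernel.comap_apply] using this

/-- Real-valued version. -/
def gf (P : Kernel (F × E) E) (A : Set E) (s : ℕ → F) (n : ℕ) (y : E) : ℝ :=
  (ef P A (bl s n) y).toReal

lemma gf_measurable (P : Kernel (F × E) E) {A : Set E} (hA : MeasurableSet A) (s : ℕ → F) (n : ℕ) :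
    Measurable (gf P A s n) := (ef_measurable P hA _).ennreal_toReal

lemma gf_nonneg (P : Kernel (F × E) E) (A : Set E) (s : ℕ → F) (n : ℕ) (y : E) :
    0 ≤ gf P A s n y := ENNReal.toReal_nonneg

lemma gf_le_one (P : Kernel (F × E) E) [IsMarkovKernel P] (A : Set E) (s : ℕ → F) (n : ℕ) (y : E) :
    gf P A s n y ≤ 1 := by
  have := ENNReal.toReal_mono ENNReal.one_ne_top (ef_le_one P A (bl s n) y)
  simpa [gf] using this

lemma gf_succ (P : Kernel (F × E) E) [IsMarkovKernel P] {A : Set E} (hA : MeasurableSet A)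
    (s : ℕ → F) (n : ℕ) (y : E) :
    gf P A s (n + 1) y = ∫ z, gf P A s n z ∂(P (s n, y)) := by
  unfold gf
  rw [integral_toReal (ef_measurable P hA _).aemeasurable
    (Eventually.of_forall fun z => (ef_le_one P A _ z).trans_lt ENNReal.one_lt_top)]
  rfl

end kern
section stepsec

lemma exists_center {E : Type*} [Nonempty E] {φ w : E → ℝ} (h : ∀ y y', φ y - φ y' ≤ w y + w y') :
    ∃ c : ℝ, ∀ y, |φ y - c| ≤ w y := by
  obtain ⟨y0⟩ := ‹Nonempty E›
  have hbd : ∀ y', BddAbove (Set.range fun y => φ y - w y) := fun y' =>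
    ⟨φ y' + w y', by rintro _ ⟨y, rfl⟩; have := h y y'; dsimp only; linarith⟩
  have : Nonempty E := ⟨y0⟩
  refine ⟨⨆ y, (φ y - w y), fun y => ?_⟩
  have h1 : φ y - w y ≤ ⨆ y, (φ y - w y) := le_ciSup (hbd y0) y
  have h2 : (⨆ y, (φ y - w y)) ≤ φ y + w y := ciSup_le fun y' => by
    have := h y' y; linarith
  rw [abs_le]; constructor <;> linarith

variable {E : Type*} [MeasurableSpace E]

lemma integrable_unit {p : Measure E} [IsProbabilityMeasure p] {φ : E → ℝ} (hφ : Measurable φ)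
    (h0 : ∀ y, 0 ≤ φ y) (h1 : ∀ y, φ y ≤ 1) : Integrable φ p :=
  Integrable.of_bound hφ.aestronglyMeasurable 1
    (Eventually.of_forall fun y => by rw [Real.norm_eq_abs, abs_of_nonneg (h0 y)]; exact h1 y)

lemma int_aff {p : Measure E} [IsProbabilityMeasure p] {φ u : E → ℝ} (hφ : Integrable φ p)
    (hu : Integrable u p) (c0 c1 c2 : ℝ) :
    ∫ y, (c0 + c1 * u y + c2 * φ y) ∂p = c0 + c1 * ∫ y, u y ∂p + c2 * ∫ y, φ y ∂p := by
  have i1 : Integrable (fun y => c0 + c1 * u y) p := (integrable_const _).add (hu.const_mul _)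
  rw [integral_add i1 (hφ.const_mul _), integral_add (integrable_const _) (hu.const_mul _),
    integral_const_mul, integral_const_mul]
  simp

lemma int_aff1 {p : Measure E} [IsProbabilityMeasure p] {φ u : E → ℝ} (hφ : Integrable φ p)
    (hu : Integrable u p) (M β c : ℝ) :
    ∫ y, (M * (1 + β * u y) - φ y + c) ∂p
      = M * (1 + β * ∫ y, u y ∂p) - ∫ y, φ y ∂p + c := by
  have := int_aff hφ hu (M + c) (M * β) (-1)
  rw [show (fun y => M * (1 + β * u y) - φ y + c)
    = fun y => (M + c) + (M * β) * u y + (-1) * φ y from funext fun y => by ring, this]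
  ring

lemma int_aff2 {p : Measure E} [IsProbabilityMeasure p] {φ u : E → ℝ} (hφ : Integrable φ p)
    (hu : Integrable u p) (M β c : ℝ) :
    ∫ y, (M * (1 + β * u y) + φ y - c) ∂p
      = M * (1 + β * ∫ y, u y ∂p) + ∫ y, φ y ∂p - c := by
  have := int_aff hφ hu (M - c) (M * β) 1
  rw [show (fun y => M * (1 + β * u y) + φ y - c)
    = fun y => (M - c) + (M * β) * u y + 1 * φ y from funext fun y => by ring, this]
  ring

lemma step_bad {p p' : Measure E} [IsProbabilityMeasure p] [IsProbabilityMeasure p']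
    {φ u : E → ℝ} (hφ : Measurable φ) (h0 : ∀ y, 0 ≤ φ y) (h1 : ∀ y, φ y ≤ 1)
    (hu : Integrable u p) (hu' : Integrable u p') {M β ρ a a' : ℝ} (hM : 0 ≤ M)
    (hβ : 0 ≤ β) (hρ : ρ ≤ 1) (ha : 0 ≤ a) (ha' : 0 ≤ a')
    (h : ∀ y y', φ y - φ y' ≤ M * (2 + β * u y + β * u y'))
    (hp : ∫ y, u y ∂p ≤ ρ * a + 1) (hp' : ∫ y, u y ∂p' ≤ ρ * a' + 1) :
    ∫ y, φ y ∂p - ∫ y, φ y ∂p' ≤ (1 + β) * M * (2 + β * a + β * a') := by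
  have : Nonempty E := p.nonempty_of_neZero
  obtain ⟨c, hc⟩ := exists_center (φ := φ) (w := fun y => M * (1 + β * u y))
    (fun y y' => by have := h y y'; linarith)
  have n1 : ∀ y, 0 ≤ M * (1 + β * u y) - φ y + c := fun y => by
    have := (abs_le.1 (hc y)).2; linarith
  have n2 : ∀ y, 0 ≤ M * (1 + β * u y) + φ y - c := fun y => by
    have := (abs_le.1 (hc y)).1; linarith
  have e1 : 0 ≤ ∫ y, (M * (1 + β * u y) - φ y + c) ∂p := integral_nonneg n1
  have e2 : 0 ≤ ∫ y, (M * (1 + β * u y) + φ y - c) ∂p' := integral_nonneg n2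
  rw [int_aff1 (integrable_unit hφ h0 h1) hu] at e1
  rw [int_aff2 (integrable_unit hφ h0 h1) hu'] at e2
  have k1 : M * (1 + β * ∫ y, u y ∂p) ≤ M * (1 + β * (a + 1)) := by
    have : ρ * a ≤ a := by nlinarith
    gcongr; linarith
  have k2 : M * (1 + β * ∫ y, u y ∂p') ≤ M * (1 + β * (a' + 1)) := by
    have : ρ * a' ≤ a' := by nlinarith
    gcongr; linarith
  have k3 : M * (2 + β * (a + 1) + β * (a' + 1)) ≤ M * ((1 + β) * (2 + β * a + β * a')) := by
    gcongr
    have : 0 ≤ β * (β * a + β * a') := by positivity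
    nlinarith
  linarith

lemma step_good {p p' ν : Measure E} [IsProbabilityMeasure p] [IsProbabilityMeasure p']
    [IsProbabilityMeasure ν]
    {φ u : E → ℝ} (hφ : Measurable φ) (h0 : ∀ y, 0 ≤ φ y) (h1 : ∀ y, φ y ≤ 1)
    (hun : ∀ y, 0 ≤ u y)
    (hu : Integrable u p) (hu' : Integrable u p') {M β ρ a a' ε R : ℝ} (hM : 0 ≤ M)
    (hβ : 0 ≤ β) (hρ0 : 0 ≤ ρ) (hρ : ρ < 1) (ha : 0 ≤ a) (ha' : 0 ≤ a')
    (h : ∀ y y', φ y - φ y' ≤ M * (2 + β * u y + β * u y'))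
    (hp : ∫ y, u y ∂p ≤ ρ * a + 1) (hp' : ∫ y, u y ∂p' ≤ ρ * a' + 1)
    (hβρ : β ≤ (1 - ρ) / 2) (hβε : 2 * β ≤ ε) (hε0 : 0 < ε) (hR : R = 8 / (1 - ρ))
    (hs : a ≤ R → ENNReal.ofReal ε • ν ≤ p) (hs' : a' ≤ R → ENNReal.ofReal ε • ν ≤ p') :
    ∫ y, φ y ∂p - ∫ y, φ y ∂p' ≤ (1 - β) * M * (2 + β * a + β * a') := by
  have : Nonempty E := p.nonempty_of_neZero
  obtain ⟨c, hc⟩ := exists_center (φ := φ) (w := fun y => M * (1 + β * u y))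
    (fun y y' => by have := h y y'; linarith)
  have i1 : Integrable (fun y => M * (1 + β * u y) - φ y + c) p :=
    ((((integrable_const _).add (hu.const_mul _)).const_mul _).sub
      (integrable_unit hφ h0 h1)).add (integrable_const _)
  have i2 : Integrable (fun y => M * (1 + β * u y) + φ y - c) p' :=
    ((((integrable_const _).add (hu'.const_mul _)).const_mul _).add
      (integrable_unit hφ h0 h1)).sub (integrable_const _)
  have n1 : ∀ y, 0 ≤ M * (1 + β * u y) - φ y + c := fun y => by
    have := (abs_le.1 (hc y)).2; linarith
  have n2 : ∀ y, 0 ≤ M * (1 + β * u y) + φ y - c := fun y => by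
    have := (abs_le.1 (hc y)).1; linarith
  have v1 := int_aff1 (integrable_unit (p := p) hφ h0 h1) hu M β c
  have v2 := int_aff2 (integrable_unit (p := p') hφ h0 h1) hu' M β c
  have k1 : M * (1 + β * ∫ y, u y ∂p) ≤ M * (1 + β * (ρ * a + 1)) := by gcongr
  have k2 : M * (1 + β * ∫ y, u y ∂p') ≤ M * (1 + β * (ρ * a' + 1)) := by gcongr
  by_cases hS : a + a' < R
  · have q1 := hs (by linarith)
    have q2 := hs' (by linarith)
    have m1 : ε * ∫ y, (M * (1 + β * u y) - φ y + c) ∂ν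
        ≤ ∫ y, (M * (1 + β * u y) - φ y + c) ∂p := by
      have := integral_mono_measure q1 (Eventually.of_forall n1) i1
      rwa [integral_smul_measure, ENNReal.toReal_ofReal hε0.le, smul_eq_mul] at this
    have m2 : ε * ∫ y, (M * (1 + β * u y) + φ y - c) ∂ν
        ≤ ∫ y, (M * (1 + β * u y) + φ y - c) ∂p' := by
      have := integral_mono_measure q2 (Eventually.of_forall n2) i2
      rwa [integral_smul_measure, ENNReal.toReal_ofReal hε0.le, smul_eq_mul] at this
    have hε' : ENNReal.ofReal ε ≠ 0 := by simpa using hε0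
    have j1 : Integrable (fun y => M * (1 + β * u y) - φ y + c) ν :=
      (integrable_smul_measure hε' ENNReal.ofReal_ne_top).1 (i1.mono_measure q1)
    have j2 : Integrable (fun y => M * (1 + β * u y) + φ y - c) ν :=
      (integrable_smul_measure hε' ENNReal.ofReal_ne_top).1 (i2.mono_measure q2)
    have hsum : 2 * M ≤ ∫ y, (M * (1 + β * u y) - φ y + c) ∂ν
        + ∫ y, (M * (1 + β * u y) + φ y - c) ∂ν := by
      rw [← integral_add j1 j2]
      calc 2 * M = ∫ y, (2 * M) ∂ν := by simp
        _ ≤ _ := by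
          refine integral_mono (integrable_const _) (j1.add j2) fun y => ?_
          have : 0 ≤ M * (β * u y) := mul_nonneg hM (mul_nonneg hβ (hun y))
          dsimp only
          linarith
    have hsum' := mul_le_mul_of_nonneg_left hsum hε0.le
    rw [v1] at m1
    rw [v2] at m2
    have key : M * (2 + β * (ρ * a + 1) + β * (ρ * a' + 1) - 2 * ε)
        ≤ M * ((1 - β) * (2 + β * a + β * a')) := by
      gcongr
      have : 0 ≤ β * (a + a') * (1 - ρ - β) := by
        have : 0 ≤ 1 - ρ - β := by linarith
        positivity
      nlinarith
    nlinarith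
  · push Not at hS
    have e1 : 0 ≤ ∫ y, (M * (1 + β * u y) - φ y + c) ∂p := integral_nonneg n1
    have e2 : 0 ≤ ∫ y, (M * (1 + β * u y) + φ y - c) ∂p' := integral_nonneg n2
    rw [v1] at e1
    rw [v2] at e2
    have key : M * (2 + β * (ρ * a + 1) + β * (ρ * a' + 1))
        ≤ M * ((1 - β) * (2 + β * a + β * a')) := by
      gcongr
      have hR' : 8 ≤ (a + a') * (1 - ρ) := by
        rw [hR, div_le_iff₀ (by linarith)] at hS; exact hS
      have : 4 ≤ (a + a') * (1 - ρ - β) := by nlinarith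
      have := mul_le_mul_of_nonneg_left this hβ
      nlinarith
    linarith

end stepsec
section maximal

variable {α : Type*} [MeasurableSpace α]

/-- Running maximum of Birkhoff sums, `max_{0 ≤ n ≤ N} S_n f`. -/
def maxBS (T : α → α) (f : α → ℝ) (N : ℕ) (x : α) : ℝ :=
  (Finset.range (N + 1)).sup' ⟨0, by simp⟩ (fun n => birkhoffSum T f n x)

lemma le_maxBS (T : α → α) (f : α → ℝ) {N n : ℕ} (h : n ≤ N) (x : α) :
    birkhoffSum T f n x ≤ maxBS T f N x :=
  Finset.le_sup' (s := Finset.range (N + 1)) (fun n => birkhoffSum T f n x) (by simp; omega)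

lemma maxBS_pos_iff (T : α → α) (f : α → ℝ) (N : ℕ) (x : α) :
    0 < maxBS T f N x ↔ ∃ n ≤ N, 0 < birkhoffSum T f n x := by
  unfold maxBS
  refine (Finset.lt_sup'_iff _).trans ?_
  simp [Nat.lt_succ_iff]

lemma birkhoffSum_int {μ : Measure α} {T : α → α} (hT : MeasurePreserving T μ μ)
    {f : α → ℝ} (hi : Integrable f μ) (n : ℕ) : Integrable (fun x => birkhoffSum T f n x) μ := by
  unfold birkhoffSum
  refine integrable_finsetSum _ fun i _ => ?_
  exact (hT.iterate i).integrable_comp_of_integrable hi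

lemma maxBS_int {μ : Measure α} {T : α → α} (hT : MeasurePreserving T μ μ)
    {f : α → ℝ} (hi : Integrable f μ) (N : ℕ) : Integrable (maxBS T f N) μ := by
  unfold maxBS
  have : ∀ (s : Finset ℕ) (hs : s.Nonempty),
      Integrable (fun x => s.sup' hs (fun n => birkhoffSum T f n x)) μ := by
    intro s hs
    induction hs using Finset.Nonempty.cons_induction with
    | singleton a => simpa using birkhoffSum_int hT hi a
    | cons a s h hs ih =>
      simp only [Finset.sup'_cons hs]
      exact (birkhoffSum_int hT hi a).sup ih
  exact this _ _

lemma birkhoffSum_meas {T : α → α} (hT : Measurable T) {f : α → ℝ} (hf : Measurable f) (n : ℕ) :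
    Measurable (fun x => birkhoffSum T f n x) := by
  unfold birkhoffSum
  exact Finset.measurable_sum _ fun i _ => hf.comp (hT.iterate i)

/-- Maximal ergodic theorem (Hopf), Garsia's proof. -/
lemma hopf {μ : Measure α} {T : α → α} (hT : MeasurePreserving T μ μ)
    {f : α → ℝ} (hf : Measurable f) (hi : Integrable f μ) (N : ℕ) :
    0 ≤ ∫ x in {x | 0 < maxBS T f N x}, f x ∂μ := by
  have hM := maxBS_int hT hi N
  have hMm : Measurable (maxBS T f N) := by
    unfold maxBS
    exact Finset.measurable_range_sup'' fun n _ => birkhoffSum_meas hT.measurable hf n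
  have hA : MeasurableSet {x | 0 < maxBS T f N x} := measurableSet_lt measurable_const hMm
  have hMT : Integrable (fun x => maxBS T f N (T x)) μ := hT.integrable_comp_of_integrable hM
  have hnn : ∀ x, 0 ≤ maxBS T f N x := fun x => by
    simpa using le_maxBS T f (Nat.zero_le N) x
  have key : ∀ x ∈ {x | 0 < maxBS T f N x}, maxBS T f N x - maxBS T f N (T x) ≤ f x := by
    intro x hx
    obtain ⟨n, hn, hn'⟩ := Finset.exists_mem_eq_sup' (s := Finset.range (N + 1)) ⟨0, by simp⟩
      (fun n => birkhoffSum T f n x)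
    have hn'' : maxBS T f N x = birkhoffSum T f n x := hn'
    rcases n with _ | n
    · rw [Set.mem_ofPred_eq, hn''] at hx; simp at hx
    · rw [hn'', birkhoffSum_succ']
      have h2 : birkhoffSum T f n (T x) ≤ maxBS T f N (T x) :=
        le_maxBS T f (by simp at hn; omega) _
      linarith
  calc (0 : ℝ) = ∫ x, maxBS T f N x ∂μ - ∫ x, maxBS T f N (T x) ∂μ := by
        have := hT.map_eq
        have h3 : ∫ x, maxBS T f N (T x) ∂μ = ∫ x, maxBS T f N x ∂μ := by
          conv_rhs => rw [← this]
          rw [integral_map hT.measurable.aemeasurable hMm.aestronglyMeasurable]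
        rw [h3, sub_self]
    _ ≤ ∫ x in {x | 0 < maxBS T f N x}, maxBS T f N x ∂μ
        - ∫ x in {x | 0 < maxBS T f N x}, maxBS T f N (T x) ∂μ := by
        refine sub_le_sub ?_ (setIntegral_le_integral hMT (Eventually.of_forall fun x => hnn _))
        refine le_of_eq (setIntegral_eq_integral_of_forall_compl_eq_zero fun x hx => ?_).symm
        exact le_antisymm (not_lt.1 hx) (hnn x)
    _ = ∫ x in {x | 0 < maxBS T f N x}, (maxBS T f N x - maxBS T f N (T x)) ∂μ :=
        (integral_sub hM.integrableOn hMT.integrableOn).symm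
    _ ≤ _ := setIntegral_mono_on (hM.sub hMT).integrableOn hi.integrableOn hA key

/-- Weak type `(1,1)` maximal inequality. -/
lemma maximal_ineq {μ : Measure α} [IsProbabilityMeasure μ] {T : α → α}
    (hT : MeasurePreserving T μ μ)
    {f : α → ℝ} (hf : Measurable f) (hi : Integrable f μ) (h0 : ∀ x, 0 ≤ f x) {a : ℝ}
    (ha : 0 < a) :
    μ {x | ∃ n : ℕ, n * a < birkhoffSum T f n x} ≤ ENNReal.ofReal ((∫ x, f x ∂μ) / a) := by
  have hsum : ∀ n x, birkhoffSum T (fun x => f x - a) n x = birkhoffSum T f n x - n * a := by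
    intro n x; simp [birkhoffSum, Finset.sum_sub_distrib]
  have hg : Integrable (fun x => f x - a) μ := hi.sub (integrable_const _)
  have hgm : Measurable (fun x => f x - a) := hf.sub_const _
  have hset : {x | ∃ n : ℕ, n * a < birkhoffSum T f n x}
      = ⋃ N : ℕ, {x | 0 < maxBS T (fun x => f x - a) N x} := by
    ext x
    simp only [Set.mem_ofPred_eq, Set.mem_iUnion, maxBS_pos_iff, hsum, sub_pos]
    constructor
    · rintro ⟨n, hn⟩; exact ⟨n, n, by simp, hn⟩
    · rintro ⟨N, n, _, hn⟩; exact ⟨n, hn⟩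
  have hmono : Monotone fun N : ℕ => {x | 0 < maxBS T (fun x => f x - a) N x} := by
    intro N N' h x hx
    simp only [Set.mem_ofPred_eq, maxBS_pos_iff] at hx ⊢
    obtain ⟨n, hn, hn'⟩ := hx
    exact ⟨n, by omega, hn'⟩
  rw [hset, hmono.measure_iUnion]
  refine iSup_le fun N => ?_
  have hh := hopf hT hgm hg N
  set A := {x | 0 < maxBS T (fun x => f x - a) N x}
  rw [integral_sub hi.integrableOn (integrable_const _)] at hh
  have h1 : ∫ x in A, f x ∂μ ≤ ∫ x, f x ∂μ := setIntegral_le_integral hi (Eventually.of_forall h0)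
  have h2 : ∫ x in A, a ∂μ = μ.real A * a := by simp
  rw [h2] at hh
  rw [← ENNReal.ofReal_toReal (measure_ne_top μ A)]
  apply ENNReal.ofReal_le_ofReal
  rw [le_div_iff₀ ha]
  change μ.real A * a ≤ _
  linarith

end maximal
section limit

lemma exists_limit {E : Type*} [MeasurableSpace E] (m : ℕ → Measure E)
    (hm : ∀ n, IsProbabilityMeasure (m n)) {C κ : ℝ} (hκ0 : 0 ≤ κ) (hκ : κ < 1)
    (h : ∀ A, MeasurableSet A → ∀ n, |(m n).real A - (m (n + 1)).real A| ≤ C * κ ^ n) :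
    ∃ p : Measure E, IsProbabilityMeasure p ∧
      ∀ A, MeasurableSet A → Tendsto (fun n => (m n).real A) atTop (nhds (p.real A)) := by
  have hex : ∀ A, ∃ l : ℝ, MeasurableSet A → Tendsto (fun n => (m n).real A) atTop (nhds l) := by
    intro A
    by_cases hA : MeasurableSet A
    · obtain ⟨l, hl⟩ := cauchySeq_tendsto_of_complete
        (cauchySeq_of_le_geometric (f := fun n => (m n).real A) κ C hκ (fun n => h A hA n))
      exact ⟨l, fun _ => hl⟩
    · exact ⟨0, fun h => absurd h hA⟩
  choose l hl using hex
  have hl0 : ∀ A, MeasurableSet A → 0 ≤ l A := fun A hA =>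
    ge_of_tendsto' (hl A hA) fun n => measureReal_nonneg
  have hbd : ∀ A, MeasurableSet A → ∀ n, |(m n).real A - l A| ≤ C * κ ^ n / (1 - κ) :=
    fun A hA n => dist_le_of_le_geometric_of_tendsto (f := fun n => (m n).real A) κ C hκ (fun n => h A hA n) (hl A hA) n
  have hbd0 : Tendsto (fun n : ℕ => C * κ ^ n / (1 - κ)) atTop (nhds 0) := by
    have := ((tendsto_pow_atTop_nhds_zero_of_lt_one hκ0 hκ).const_mul C).div_const (1 - κ)
    simpa using this
  have hsum : ∀ A : ℕ → Set E, (∀ i, MeasurableSet (A i)) → Pairwise (Function.onFun Disjoint A) →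
      HasSum (fun i => l (A i)) (l (⋃ i, A i)) := by
    intro A hA hd
    have hU : MeasurableSet (⋃ i, A i) := MeasurableSet.iUnion hA
    rw [hasSum_iff_tendsto_nat_of_nonneg (fun i => hl0 _ (hA i))]
    have hfin : ∀ k n, |(m n).real (⋃ i ∈ Finset.range k, A i) - ∑ i ∈ Finset.range k, l (A i)|
        ≤ C * κ ^ n / (1 - κ) := by
      intro k n
      have hB : MeasurableSet (⋃ i ∈ Finset.range k, A i) :=
        Finset.measurableSet_biUnion _ fun i _ => hA i
      have e : ∀ n, (m n).real (⋃ i ∈ Finset.range k, A i)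
          = ∑ i ∈ Finset.range k, (m n).real (A i) := fun n =>
        measureReal_biUnion_finset (fun i _ j _ hij => hd hij) fun i _ => hA i
      have e2 : l (⋃ i ∈ Finset.range k, A i) = ∑ i ∈ Finset.range k, l (A i) := by
        refine tendsto_nhds_unique (hl _ hB) ?_
        simp_rw [e]
        exact tendsto_finsetSum _ fun i _ => hl _ (hA i)
      rw [← e2]
      exact hbd _ hB n
    rw [Metric.tendsto_atTop]
    intro ε hε
    obtain ⟨n, hn⟩ := (hbd0.eventually (gt_mem_nhds (show (0 : ℝ) < ε / 3 by positivity))).exists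
    have hs : HasSum (fun i => (m n).real (A i)) ((m n).real (⋃ i, A i)) := by
      have := (measure_iUnion (μ := m n) hd hA)
      have hne : ∑' i, m n (A i) ≠ ∞ := by rw [← this]; exact measure_ne_top _ _
      have h2 := ENNReal.hasSum_toReal hne
      rw [← ENNReal.tsum_toReal_eq (fun i => measure_ne_top _ _), ← this] at h2
      exact h2
    obtain ⟨K, hK⟩ := Metric.tendsto_atTop.1 hs.tendsto_sum_nat (ε / 3) (by positivity)
    refine ⟨K, fun k hk => ?_⟩
    have h1 := hfin k n
    have h2 := hbd _ hU n
    have h3 := hK k hk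
    rw [measureReal_biUnion_finset (fun i _ j _ hij => hd hij) fun i _ => hA i] at h1
    rw [Real.dist_eq] at h3 ⊢
    rw [abs_le] at h1 h2
    rw [abs_lt] at h3 ⊢
    constructor <;> linarith [h1.1, h1.2, h2.1, h2.2, h3.1, h3.2]
  have hempty : l ∅ = 0 := by
    refine tendsto_nhds_unique (hl _ MeasurableSet.empty) ?_
    simp
  have huniv : l Set.univ = 1 := by
    refine tendsto_nhds_unique (hl _ MeasurableSet.univ) ?_
    simp
  let p : Measure E := Measure.ofMeasurable (fun A _ => ENNReal.ofReal (l A)) (by simp [hempty])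
    (fun A hA hd => by
      have := hsum A hA hd
      rw [← this.tsum_eq, ENNReal.ofReal_tsum_of_nonneg (fun i => hl0 _ (hA i)) this.summable])
  have hp : ∀ A, MeasurableSet A → p A = ENNReal.ofReal (l A) := fun A hA =>
    Measure.ofMeasurable_apply A hA
  refine ⟨p, ⟨by rw [hp _ MeasurableSet.univ, huniv]; simp⟩, fun A hA => ?_⟩
  have : p.real A = l A := by
    rw [Measure.real, hp A hA, ENNReal.toReal_ofReal (hl0 A hA)]
  rw [this]
  exact hl A hA

end limit

section det

/-- number of bad indices below `n` -/
def badCount (bad : ℕ → Prop) (n : ℕ) : ℕ :=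
  open Classical in ∑ k ∈ Finset.range n, if bad k then 1 else 0

/-- contraction constants -/
def Mc (bad : ℕ → Prop) (β : ℝ) : ℕ → ℝ
  | 0 => 1
  | n + 1 => open Classical in (if bad n then 1 + β else 1 - β) * Mc bad β n

lemma Mc_nonneg (bad : ℕ → Prop) {β : ℝ} (h0 : 0 ≤ β) (h1 : β ≤ 1) (n : ℕ) :
    0 ≤ Mc bad β n := by
  induction n with
  | zero => simp [Mc]
  | succ n ih =>
    rw [Mc]
    refine mul_nonneg ?_ ih
    split_ifs <;> linarith

lemma Mc_le (bad : ℕ → Prop) {β : ℝ} (h0 : 0 ≤ β) (h1 : β < 1)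
    (hb : ∀ n, 4 * badCount bad n ≤ n) (n : ℕ) : Mc bad β n ≤ √(1 - β) ^ n := by
  set κ := √(1 - β) with hκ
  have hκ2 : κ ^ 2 = 1 - β := Real.sq_sqrt (by linarith)
  have hκ0 : 0 < κ := Real.sqrt_pos.2 (by linarith)
  have hκ1 : κ ≤ 1 := by
    rw [hκ, Real.sqrt_le_one]; linarith
  have key : ∀ n, Mc bad β n * κ ^ (4 * badCount bad n) ≤ κ ^ (2 * n) := by
    intro n
    induction n with
    | zero => simp [Mc, badCount]
    | succ n ih =>
      have hM := Mc_nonneg bad h0 h1.le n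
      by_cases hbad : bad n
      · have e1 : badCount bad (n + 1) = badCount bad n + 1 := by
          rw [badCount, Finset.sum_range_succ]; simp [badCount, hbad]
        have e2 : Mc bad β (n + 1) = (1 + β) * Mc bad β n := by simp [Mc, hbad]
        rw [e1, e2]
        calc (1 + β) * Mc bad β n * κ ^ (4 * (badCount bad n + 1))
            = (Mc bad β n * κ ^ (4 * badCount bad n)) * ((1 + β) * κ ^ 2) * κ ^ 2 := by ring
          _ ≤ κ ^ (2 * n) * 1 * κ ^ 2 := by
            gcongr
            rw [hκ2]; nlinarith
          _ = κ ^ (2 * (n + 1)) := by ring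
      · have e1 : badCount bad (n + 1) = badCount bad n := by
          rw [badCount, Finset.sum_range_succ]; simp [badCount, hbad]
        have e2 : Mc bad β (n + 1) = κ ^ 2 * Mc bad β n := by simp [Mc, hbad, hκ2]
        rw [e1, e2]
        calc κ ^ 2 * Mc bad β n * κ ^ (4 * badCount bad n)
            = (Mc bad β n * κ ^ (4 * badCount bad n)) * κ ^ 2 := by ring
          _ ≤ κ ^ (2 * n) * κ ^ 2 := by gcongr
          _ = κ ^ (2 * (n + 1)) := by ring
  have h3 : Mc bad β n * κ ^ n ≤ κ ^ n * κ ^ n := by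
    calc Mc bad β n * κ ^ n ≤ Mc bad β n * κ ^ (4 * badCount bad n) :=
          mul_le_mul_of_nonneg_left (pow_le_pow_of_le_one hκ0.le hκ1 (hb n))
            (Mc_nonneg bad h0 h1.le n)
      _ ≤ κ ^ (2 * n) := key n
      _ = κ ^ n * κ ^ n := by ring
  exact le_of_mul_le_mul_right h3 (pow_pos hκ0 n)

variable {E F : Type*} [MeasurableSpace E] [MeasurableSpace F]

lemma drift_int (p : Measure E) {V : E → ℝ} (hVmeas : Measurable V)
    (hVpos : ∀ y, 0 < V y) {l b v q q' ρ : ℝ} (hl : 0 ≤ l) (hb : 0 ≤ b) (hv : 0 ≤ v)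
    (hd : ∫⁻ z, ENNReal.ofReal (V z) ∂p ≤
      ENNReal.ofReal l * ENNReal.ofReal v + ENNReal.ofReal b)
    (hq : 1 ≤ q) (hq' : 1 ≤ q') (hqb : b ≤ q) (hql : l * q' ≤ ρ * q) :
    Integrable (fun z => V z / q) p ∧ ∫ z, V z / q ∂p ≤ ρ * (v / q') + 1 := by
  rw [← ENNReal.ofReal_mul hl, ← ENNReal.ofReal_add (by positivity) hb] at hd
  have hVi : Integrable V p := by
    refine ⟨hVmeas.aestronglyMeasurable, ?_⟩
    rw [hasFiniteIntegral_iff_ofReal (Eventually.of_forall fun y => (hVpos y).le)]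
    exact hd.trans_lt ENNReal.ofReal_lt_top
  refine ⟨hVi.div_const q, ?_⟩
  have hV : ∫ z, V z ∂p ≤ l * v + b := by
    rw [integral_eq_lintegral_of_nonneg_ae (Eventually.of_forall fun y => (hVpos y).le)
      hVmeas.aestronglyMeasurable]
    exact ENNReal.toReal_le_of_le_ofReal (by positivity) hd
  rw [integral_div]
  have hq0 : 0 < q := by linarith
  have hq0' : 0 < q' := by linarith
  calc (∫ z, V z ∂p) / q ≤ (l * v + b) / q := by gcongr
    _ = l / q * v + b / q := by ring
    _ ≤ ρ / q' * v + 1 := by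
      have h1 : l / q ≤ ρ / q' := by rw [div_le_div_iff₀ hq0 hq0']; exact hql
      have h2 : b / q ≤ 1 := by rw [div_le_one hq0]; exact hqb
      have h3 := mul_le_mul_of_nonneg_right h1 hv
      linarith
    _ = _ := by ring

theorem det_main [Nonempty E] (P : Kernel (F × E) E) [IsMarkovKernel P]
    (V : E → ℝ) (hVmeas : Measurable V) (hVpos : ∀ y, 0 < V y)
    (lam b : F → ℝ) (hlam0 : ∀ x, 0 ≤ lam x) (hb0 : ∀ x, 0 ≤ b x)
    (hdrift : ∀ (x : F) (y : E), ∫⁻ z, ENNReal.ofReal (V z) ∂(P (x, y)) ≤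
      ENNReal.ofReal (lam x) * ENNReal.ofReal (V y) + ENNReal.ofReal (b x))
    (η : ℝ → F → ℝ)
    (hsmall : ∀ R > (0 : ℝ), ∃ ν : Kernel F E, IsMarkovKernel ν ∧
      ∀ (x : F) (y : E) (A : Set E), MeasurableSet A → V y ≤ R →
        ENNReal.ofReal (η R x) * ν x A ≤ P (x, y) A)
    (s : ℕ → F) (q : ℕ → ℝ) {ρ β R : ℝ} (hρ0 : 0 < ρ) (hρ1 : ρ < 1) (hβ0 : 0 < β)
    (hβρ : β ≤ (1 - ρ) / 2) (hR : R = 8 / (1 - ρ))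
    (hq1 : ∀ n, 1 ≤ q n) (hqb : ∀ n, b (s n) ≤ q n)
    (hql : ∀ n, lam (s n) * q (n + 1) ≤ ρ * q n)
    (hbad : ∀ n, 4 * badCount (fun n => η (R * q (n + 1)) (s n) < 2 * β) n ≤ n) :
    ∃ p : Measure E, IsProbabilityMeasure p ∧ ∀ z A n, MeasurableSet A →
      |gf P A s n z - p.real A| ≤ 3 * (1 + V z) * √(1 - β) ^ n / (1 - √(1 - β)) := by
  set bad : ℕ → Prop := fun n => η (R * q (n + 1)) (s n) < 2 * β with hbaddef
  have hβ1 : β < 1 := by linarith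
  have hRpos : 0 < R := by rw [hR]; exact div_pos (by norm_num) (by linarith)
  have hdi := fun n y => drift_int (P (s n, y)) hVmeas hVpos (hlam0 (s n)) (hb0 (s n))
    (hVpos y).le (hdrift (s n) y) (hq1 n) (hq1 (n + 1)) (hqb n) (hql n)
  have hq0 : ∀ n, 0 < q n := fun n => by linarith [hq1 n]
  have hVq : ∀ n y, 0 ≤ V y / q n := fun n y => div_nonneg (hVpos y).le (hq0 n).le
  have hVq' : ∀ n y, V y / q n ≤ V y := fun n y => div_le_self (hVpos y).le (hq1 n)
  have main : ∀ A, MeasurableSet A → ∀ n y y', gf P A s n y - gf P A s n y' ≤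
      Mc bad β n * (2 + β * (V y / q n) + β * (V y' / q n)) := by
    intro A hA n
    induction n with
    | zero =>
      intro y y'
      have h1 := gf_le_one P A s 0 y
      have h2 := gf_nonneg P A s 0 y'
      have h3 := mul_nonneg hβ0.le (hVq 0 y)
      have h4 := mul_nonneg hβ0.le (hVq 0 y')
      simp only [Mc, one_mul]
      linarith
    | succ n ih =>
      intro y y'
      rw [gf_succ P hA, gf_succ P hA]
      by_cases hb : bad n
      · have e2 : Mc bad β (n + 1) = (1 + β) * Mc bad β n := by simp [Mc, hb]
        rw [e2]
        exact step_bad (gf_measurable P hA s n) (gf_nonneg P A s n) (gf_le_one P A s n)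
          (hdi n y).1 (hdi n y').1 (Mc_nonneg bad hβ0.le hβ1.le n) hβ0.le hρ1.le
          (hVq _ _) (hVq _ _) ih (hdi n y).2 (hdi n y').2
      · have e2 : Mc bad β (n + 1) = (1 - β) * Mc bad β n := by simp [Mc, hb]
        rw [e2]
        obtain ⟨ν, hν, hνs⟩ := hsmall (R * q (n + 1)) (mul_pos hRpos (hq0 _))
        have hε : 2 * β ≤ η (R * q (n + 1)) (s n) := not_lt.1 hb
        have hle : ∀ y, V y / q (n + 1) ≤ R →
            ENNReal.ofReal (η (R * q (n + 1)) (s n)) • ν (s n) ≤ P (s n, y) := by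
          intro y hy
          rw [div_le_iff₀ (hq0 _)] at hy
          refine Measure.le_iff.2 fun A hA => ?_
          simpa using hνs (s n) y A hA hy
        exact step_good (ν := ν (s n)) (gf_measurable P hA s n) (gf_nonneg P A s n)
          (gf_le_one P A s n) (hVq n)
          (hdi n y).1 (hdi n y').1 (Mc_nonneg bad hβ0.le hβ1.le n) hβ0.le hρ0.le hρ1
          (hVq _ _) (hVq _ _) ih (hdi n y).2 (hdi n y').2 hβρ hε (by linarith) hR
          (hle y) (hle y')
  have hMle := Mc_le bad hβ0.le hβ1 hbad
  set κ := √(1 - β) with hκ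
  have hκ0 : 0 < κ := Real.sqrt_pos.2 (by linarith)
  have hκ1 : κ < 1 := by rw [hκ, Real.sqrt_lt' one_pos]; linarith
  have incr : ∀ A, MeasurableSet A → ∀ z n,
      |gf P A s n z - gf P A s (n + 1) z| ≤ 3 * (1 + V z) * κ ^ n := by
    intro A hA z n
    have hMn := Mc_nonneg bad hβ0.le hβ1.le n
    have e : gf P A s n z - gf P A s (n + 1) z
        = ∫ y, (gf P A s n z - gf P A s n y) ∂(P (s n, z)) := by
      rw [integral_sub (integrable_const _)
        (integrable_unit (gf_measurable P hA s n) (gf_nonneg P A s n) (gf_le_one P A s n)),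
        gf_succ P hA]
      simp
    rw [e]
    have hIntg : Integrable (fun y => Mc bad β n * (2 + β * (V y / q n) + β * (V z / q n)))
        (P (s n, z)) :=
      (((integrable_const _).add ((hdi n z).1.const_mul _)).add (integrable_const _)).const_mul _
    calc |∫ y, (gf P A s n z - gf P A s n y) ∂(P (s n, z))|
        ≤ ∫ y, Mc bad β n * (2 + β * (V y / q n) + β * (V z / q n)) ∂(P (s n, z)) := by
          rw [← Real.norm_eq_abs]
          refine norm_integral_le_of_norm_le hIntg (Eventually.of_forall fun y => ?_)
          rw [Real.norm_eq_abs, abs_le]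
          have h1 := main A hA n y z
          have h2 := main A hA n z y
          constructor <;> linarith
      _ = Mc bad β n * (2 + β * (V z / q n) + β * ∫ y, V y / q n ∂(P (s n, z))) := by
          rw [integral_const_mul]
          congr 1
          have := int_aff (p := P (s n, z)) (integrable_const (0 : ℝ)) (hdi n z).1
            (2 + β * (V z / q n)) β 0
          simp only [mul_zero, add_zero, zero_mul] at this
          rw [← this]
          congr 1
          ext y
          ring
      _ ≤ Mc bad β n * (2 + 1 * V z + 1 * (V z + 1)) := by
          have h1 := (hdi n z).2
          have h2 : ρ * (V z / q (n + 1)) ≤ 1 * V z := by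
            have := hVpos z
            exact mul_le_mul hρ1.le (hVq' _ _) (hVq _ _) zero_le_one
          have h3 : β * (V z / q n) ≤ 1 * V z :=
            mul_le_mul hβ1.le (hVq' _ _) (hVq _ _) zero_le_one
          have h4 : β * ∫ y, V y / q n ∂(P (s n, z)) ≤ 1 * (V z + 1) :=
            mul_le_mul hβ1.le (by linarith) (integral_nonneg (hVq n)) zero_le_one
          refine mul_le_mul_of_nonneg_left ?_ hMn
          linarith
      _ ≤ κ ^ n * (3 * (1 + V z)) := by
          have := hVpos z
          gcongr
          · exact hMle n
          · linarith
      _ = _ := by ring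
  obtain ⟨z0⟩ := ‹Nonempty E›
  have hreal : ∀ A, MeasurableSet A → ∀ n z,
      (iterFrom P (bl s n) (Measure.dirac z)).real A = gf P A s n z := by
    intro A hA n z
    rw [Measure.real, iterFrom_dirac P hA, gf]
  obtain ⟨p, hp, hlim⟩ := exists_limit (fun n => iterFrom P (bl s n) (Measure.dirac z0))
    (fun n => ⟨by rw [iterFrom_dirac P MeasurableSet.univ, ef_univ]⟩) hκ0.le hκ1
    (C := 3 * (1 + V z0)) (fun A hA n => by
      rw [hreal A hA, hreal A hA]
      exact incr A hA z0 n)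
  refine ⟨p, hp, fun z A n hA => ?_⟩
  refine dist_le_of_le_geometric_of_tendsto (f := fun n => gf P A s n z) κ _ hκ1
    (fun n => incr A hA z n) ?_ n
  have h1 := hlim A hA
  simp_rw [hreal A hA] at h1
  have h2 : Tendsto (fun n => gf P A s n z - gf P A s n z0) atTop (nhds 0) := by
    have h3 : Tendsto (fun n => κ ^ n * (2 + V z + V z0)) atTop (nhds 0) := by
      simpa using (tendsto_pow_atTop_nhds_zero_of_lt_one hκ0.le hκ1).mul_const (2 + V z + V z0)
    refine squeeze_zero_norm (fun n => ?_) h3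
    have hz := hVpos z
    have hz0 := hVpos z0
    have hle : Mc bad β n * (2 + β * (V z / q n) + β * (V z0 / q n))
        ≤ κ ^ n * (2 + 1 * V z + 1 * V z0) := by
      have := hVq n z
      have := hVq n z0
      gcongr
      · exact hMle n
      · exact hVq' _ _
      · exact hVq' _ _
    rw [Real.norm_eq_abs, abs_le]
    have h1 := main A hA n z z0
    have h2 := main A hA n z0 z
    constructor <;> linarith
  simpa using h2.add h1

end det
section ergodic

variable {α : Type*} [MeasurableSpace α]

lemma measure_zero_of_le_seq {μ : Measure α} {A : Set α} {u : ℕ → ℝ}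
    (hu : Tendsto u atTop (nhds 0)) (h : ∀ᶠ n in atTop, μ A ≤ ENNReal.ofReal (u n)) : μ A = 0 := by
  have h2 : Tendsto (fun n => ENNReal.ofReal (u n)) atTop (nhds 0) := by
    simpa using ENNReal.tendsto_ofReal hu
  exact le_antisymm (ge_of_tendsto h2 h) zero_le

lemma ae_bdd {μ : Measure α} [IsProbabilityMeasure μ] {T : α → α} (hT : MeasurePreserving T μ μ)
    {f : α → ℝ} (hf : Measurable f) (hi : Integrable f μ) (h0 : ∀ x, 0 ≤ f x) :
    ∀ᵐ x ∂μ, ∃ K : ℕ, ∀ n : ℕ, birkhoffSum T f n x ≤ n * K := by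
  rw [ae_iff]
  refine measure_zero_of_le_seq (u := fun K : ℕ => (∫ x, f x ∂μ) / K)
    (tendsto_const_div_atTop_nhds_zero_nat _) ?_
  filter_upwards [eventually_gt_atTop 0] with K hK
  refine le_trans (measure_mono fun x hx => ?_)
    (maximal_ineq hT hf hi h0 (a := K) (by exact_mod_cast hK))
  simp only [Set.mem_ofPred_eq, not_exists, not_forall, not_le] at hx ⊢
  exact hx K

lemma ae_sublinear {μ : Measure α} [IsProbabilityMeasure μ] {T : α → α}
    (hT : MeasurePreserving T μ μ)
    {f : α → ℝ} (hf : Measurable f) (hi : Integrable f μ) (h0 : ∀ x, 0 ≤ f x) :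
    ∀ᵐ x ∂μ, ∀ j : ℕ, ∀ᶠ k : ℕ in atTop, (j + 1) * f (T^[k] x) ≤ k := by
  rw [ae_all_iff]
  intro j
  letI : MeasureSpace α := ⟨μ⟩
  have hv : (volume : Measure α) = μ := rfl
  haveI : IsProbabilityMeasure (volume : Measure α) := by rw [hv]; infer_instance
  have h1 := tsum_prob_mem_Ioi_lt_top (X := fun x => ((j : ℝ) + 1) * f x) (hi.const_mul _)
    (fun x => mul_nonneg (by positivity) (h0 x))
  rw [hv] at h1
  have h2 : ∀ k : ℕ, μ {x | ((j : ℝ) + 1) * f (T^[k] x) ∈ Set.Ioi (k : ℝ)}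
      = μ {x | ((j : ℝ) + 1) * f x ∈ Set.Ioi (k : ℝ)} := by
    intro k
    exact (hT.iterate k).measure_preimage
      ((hf.const_mul _) measurableSet_Ioi).nullMeasurableSet
  have h3 : (∑' k : ℕ, μ {x | ((j : ℝ) + 1) * f (T^[k] x) ∈ Set.Ioi (k : ℝ)}) ≠ ∞ := by
    simp_rw [h2]; exact h1.ne
  filter_upwards [ae_eventually_notMem h3] with x hx
  filter_upwards [hx] with k hk
  simpa using hk

lemma badCount_eq {T : α → α} (B : Set α) (n : ℕ) (x : α) :
    birkhoffSum T (B.indicator fun _ => (1 : ℝ)) n x = badCount (fun k => T^[k] x ∈ B) n := by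
  classical
  rw [birkhoffSum, badCount]
  push_cast
  refine Finset.sum_congr rfl fun k _ => ?_
  by_cases h : T^[k] x ∈ B <;> simp [h]

lemma ae_density {μ : Measure α} [IsProbabilityMeasure μ] {T : α → α}
    (hT : MeasurePreserving T μ μ) (B : ℕ → Set α) (hB : ∀ j, MeasurableSet (B j))
    (hanti : Antitone B) (hemp : ⋂ j, B j = ∅) (j0 : ℕ) :
    ∀ᵐ x ∂μ, ∃ j ≥ j0, ∀ n, 4 * badCount (fun k => T^[k] x ∈ B j) n ≤ n := by
  rw [ae_iff]
  have ht : Tendsto (fun j => μ.real (B j) / (1 / 4)) atTop (nhds 0) := by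
    have := tendsto_measure_iInter_atTop (μ := μ) (fun j => (hB j).nullMeasurableSet) hanti
      ⟨0, measure_ne_top _ _⟩
    rw [hemp, measure_empty] at this
    have h2 := (ENNReal.tendsto_toReal ENNReal.zero_ne_top).comp this
    simpa [Measure.real] using h2.div_const (1 / 4)
  refine measure_zero_of_le_seq ht ?_
  filter_upwards [eventually_ge_atTop j0] with j hj
  have hmax := maximal_ineq hT (f := (B j).indicator fun _ => (1 : ℝ))
    (measurable_const.indicator (hB j)) ((integrable_const _).indicator (hB j))
    (fun x => Set.indicator_nonneg (fun _ _ => zero_le_one) x) (a := 1 / 4) (by norm_num)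
  rw [integral_indicator_const _ (hB j), smul_eq_mul, mul_one] at hmax
  refine le_trans (measure_mono fun x hx => ?_) hmax
  simp only [Set.mem_ofPred_eq, not_exists, not_and, not_forall, not_le] at hx ⊢
  obtain ⟨n, hn⟩ := hx j hj
  refine ⟨n, ?_⟩
  rw [badCount_eq]
  have : (n : ℝ) < 4 * badCount (fun k => T^[k] x ∈ B j) n := by exact_mod_cast hn
  linarith

lemma ae_forward_inv {μ : Measure α} [IsProbabilityMeasure μ] {T : α → α}
    (hT : MeasurePreserving T μ μ) {C : Set α} (hC : MeasurableSet C) (hsub : T ⁻¹' C ⊆ C) :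
    ∀ᵐ x ∂μ, x ∈ C → ∀ n, T^[n] x ∈ C := by
  have h0 : μ (C \ T ⁻¹' C) = 0 := by
    rw [measure_sdiff hsub (hT.measurable hC).nullMeasurableSet (measure_ne_top _ _),
      hT.measure_preimage hC.nullMeasurableSet, tsub_self]
  have h1 : ∀ᵐ x ∂μ, x ∈ C → T x ∈ C := by
    rw [ae_iff]
    refine measure_mono_null (fun x hx => ?_) h0
    simpa using hx
  have h2 : ∀ᵐ x ∂μ, ∀ n, T^[n] x ∈ C → T (T^[n] x) ∈ C :=
    ae_all_iff.2 fun n => (hT.iterate n).quasiMeasurePreserving.ae h1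
  filter_upwards [h2] with x hx hxC n
  induction n with
  | zero => exact hxC
  | succ n ih => rw [Function.iterate_succ_apply']; exact hx n ih

end ergodic

section path

variable {F : Type*}

/-- one-sided shift -/
def sh (s : ℕ → F) : ℕ → F := fun n => s (n + 1)

lemma sh_iter (n : ℕ) (s : ℕ → F) (k : ℕ) : (sh^[n] s) k = s (k + n) := by
  induction n generalizing s with
  | zero => rfl
  | succ n ih => rw [Function.iterate_succ_apply, ih]; simp [sh]; congr 1

/-- terms of the random weight -/
def tq (lam b : F → ℝ) (ρ : ℝ) (k : ℕ) (s : ℕ → F) : ℝ :=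
  ρ⁻¹ ^ k * (∏ i ∈ Finset.range k, lam (s i)) * max (b (s k)) 1

/-- the random weight -/
def Qf (lam b : F → ℝ) (ρ : ℝ) (s : ℕ → F) : ℝ≥0∞ := ⨆ k, ENNReal.ofReal (tq lam b ρ k s)

lemma tq_zero (lam b : F → ℝ) (ρ : ℝ) (s : ℕ → F) : tq lam b ρ 0 s = max (b (s 0)) 1 := by
  simp [tq]

lemma tq_succ (lam b : F → ℝ) (ρ : ℝ) (k : ℕ) (s : ℕ → F) :
    tq lam b ρ (k + 1) s = ρ⁻¹ * lam (s 0) * tq lam b ρ k (sh s) := by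
  simp only [tq, Finset.prod_range_succ', sh]; ring

lemma one_le_Qf (lam b : F → ℝ) (ρ : ℝ) (s : ℕ → F) : 1 ≤ Qf lam b ρ s := by
  refine le_trans ?_ (le_iSup _ 0)
  rw [tq_zero]; simp

lemma b_le_Qf (lam b : F → ℝ) (ρ : ℝ) (s : ℕ → F) : ENNReal.ofReal (b (s 0)) ≤ Qf lam b ρ s := by
  refine le_trans ?_ (le_iSup _ 0)
  rw [tq_zero]; exact ENNReal.ofReal_le_ofReal (le_max_left _ _)

lemma Qf_succ (lam b : F → ℝ) (hlam0 : ∀ x, 0 ≤ lam x) {ρ : ℝ} (hρ : 0 < ρ) (s : ℕ → F) :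
    ENNReal.ofReal (ρ⁻¹ * lam (s 0)) * Qf lam b ρ (sh s)
      = ⨆ k, ENNReal.ofReal (tq lam b ρ (k + 1) s) := by
  have : 0 ≤ ρ⁻¹ * lam (s 0) := mul_nonneg (by positivity) (hlam0 _)
  simp_rw [tq_succ, ENNReal.ofReal_mul this]
  rw [Qf, ENNReal.mul_iSup]

lemma Qf_lam (lam b : F → ℝ) (hlam0 : ∀ x, 0 ≤ lam x) {ρ : ℝ} (hρ : 0 < ρ) (s : ℕ → F) :
    ENNReal.ofReal (ρ⁻¹ * lam (s 0)) * Qf lam b ρ (sh s) ≤ Qf lam b ρ s := by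
  rw [Qf_succ lam b hlam0 hρ]
  exact iSup_le fun k => le_iSup (fun k => ENNReal.ofReal (tq lam b ρ k s)) (k + 1)

lemma Qf_lt_top (lam b : F → ℝ) (hlam0 : ∀ x, 0 ≤ lam x) {ρ : ℝ} (hρ : 0 < ρ) (s : ℕ → F)
    (h : Qf lam b ρ (sh s) < ∞) : Qf lam b ρ s < ∞ := by
  have : Qf lam b ρ s ≤ max (ENNReal.ofReal (tq lam b ρ 0 s))
      (ENNReal.ofReal (ρ⁻¹ * lam (s 0)) * Qf lam b ρ (sh s)) := by
    rw [Qf_succ lam b hlam0 hρ]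
    refine iSup_le fun k => ?_
    rcases k with _ | k
    · exact le_max_left _ _
    · exact le_max_of_le_right (le_iSup (fun k => ENNReal.ofReal (tq lam b ρ (k + 1) s)) k)
  refine this.trans_lt (max_lt ENNReal.ofReal_lt_top (ENNReal.mul_lt_top ENNReal.ofReal_lt_top h))

variable [MeasurableSpace F]

lemma sh_measurable : Measurable (sh : (ℕ → F) → (ℕ → F)) :=
  measurable_pi_lambda _ fun n => measurable_pi_apply (n + 1)

lemma Qf_measurable {lam b : F → ℝ} (hlam : Measurable lam) (hb : Measurable b) (ρ : ℝ) :
    Measurable (Qf lam b ρ) := by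
  refine Measurable.iSup fun k => Measurable.ennreal_ofReal ?_
  unfold tq
  refine Measurable.mul (Measurable.mul measurable_const ?_) ?_
  · exact Finset.measurable_prod _ fun i _ => hlam.comp (measurable_pi_apply i)
  · exact (hb.comp (measurable_pi_apply k)).max measurable_const

lemma Qf_finite_of_growth {lam b : F → ℝ} (hlam0 : ∀ x, 0 ≤ lam x) {ρ r : ℝ}
    (hr : 0 < r) (hrρ : r < ρ) {s : ℕ → F}
    (h1 : ∀ᶠ n : ℕ in atTop, ∏ i ∈ Finset.range n, lam (s i) ≤ r ^ n)
    (h2 : ∀ j : ℕ, ∀ᶠ k : ℕ in atTop, (j + 1) * Real.log (max (b (s k)) 1) ≤ k) :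
    Qf lam b ρ s < ∞ := by
  have hρ : 0 < ρ := hr.trans hrρ
  have hlog : 0 < Real.log (ρ / r) := Real.log_pos (by rwa [one_lt_div hr])
  obtain ⟨j, hj⟩ := exists_nat_one_div_lt hlog
  have hev : ∀ᶠ k : ℕ in atTop, tq lam b ρ k s ≤ 1 := by
    filter_upwards [h1, h2 j] with k hk1 hk2
    have hj0 : (0 : ℝ) < j + 1 := by positivity
    have hk3 : Real.log (max (b (s k)) 1) ≤ k * Real.log (ρ / r) := by
      have : Real.log (max (b (s k)) 1) ≤ k * (1 / (j + 1)) := by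
        rw [mul_one_div, le_div_iff₀ hj0]; linarith
      refine this.trans ?_
      gcongr
    have hk4 : max (b (s k)) 1 ≤ (ρ / r) ^ k := by
      rw [← Real.log_pow] at hk3
      exact (Real.log_le_log_iff (by positivity) (by positivity)).1 hk3
    calc tq lam b ρ k s ≤ ρ⁻¹ ^ k * r ^ k * (ρ / r) ^ k := by
          unfold tq
          have : 0 ≤ ∏ i ∈ Finset.range k, lam (s i) := Finset.prod_nonneg fun i _ => hlam0 _
          gcongr
      _ = 1 := by
          rw [← mul_pow, ← mul_pow]
          have : ρ⁻¹ * r * (ρ / r) = 1 := by field_simp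
          rw [this, one_pow]
  obtain ⟨M, hM⟩ := (isBoundedUnder_of_eventually_le hev).bddAbove_range
  refine lt_of_le_of_lt (iSup_le fun k => ?_) (ENNReal.ofReal_lt_top (r := M))
  exact ENNReal.ofReal_le_ofReal (hM ⟨k, rfl⟩)

lemma prod_growth {lam : F → ℝ} (hlam0 : ∀ x, 0 ≤ lam x) {s : ℕ → F} {K : ℕ}
    (hK : ∀ n : ℕ, ∑ i ∈ Finset.range n, Real.log (max (lam (s i)) 1) ≤ n * K)
    (hlim : atTop.limsup
      (fun n : ℕ => (∏ i ∈ Finset.range n, lam (s i)) ^ ((n : ℝ)⁻¹)) < 1) :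
    ∃ r : ℝ, 0 < r ∧ r < 1 ∧ ∀ᶠ n : ℕ in atTop, ∏ i ∈ Finset.range n, lam (s i) ≤ r ^ n := by
  have hp0 : ∀ n, 0 ≤ ∏ i ∈ Finset.range n, lam (s i) := fun n =>
    Finset.prod_nonneg fun i _ => hlam0 _
  have hbdd : IsBoundedUnder (· ≤ ·) atTop
      (fun n : ℕ => (∏ i ∈ Finset.range n, lam (s i)) ^ ((n : ℝ)⁻¹)) := by
    refine isBoundedUnder_of_eventually_le (a := Real.exp K) ?_
    filter_upwards [eventually_gt_atTop 0] with n hn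
    have hn' : (0 : ℝ) < n := by exact_mod_cast hn
    have h1 : ∏ i ∈ Finset.range n, lam (s i) ≤ Real.exp K ^ (n : ℝ) := by
      calc ∏ i ∈ Finset.range n, lam (s i) ≤ ∏ i ∈ Finset.range n, max (lam (s i)) 1 :=
            Finset.prod_le_prod (fun i _ => hlam0 _) fun i _ => le_max_left _ _
        _ = Real.exp (∑ i ∈ Finset.range n, Real.log (max (lam (s i)) 1)) := by
            rw [Real.exp_sum]
            refine Finset.prod_congr rfl fun i _ => ?_
            rw [Real.exp_log (by positivity)]
        _ ≤ Real.exp (n * K) := Real.exp_le_exp.2 (hK n)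
        _ = Real.exp K ^ (n : ℝ) := by rw [← Real.exp_mul]; ring_nf
    calc (∏ i ∈ Finset.range n, lam (s i)) ^ ((n : ℝ)⁻¹)
        ≤ (Real.exp K ^ (n : ℝ)) ^ ((n : ℝ)⁻¹) :=
          Real.rpow_le_rpow (hp0 n) h1 (by positivity)
      _ = Real.exp K := Real.rpow_rpow_inv (Real.exp_pos _).le hn'.ne'
  obtain ⟨r, hr1, hr2⟩ := exists_between (max_lt hlim zero_lt_one)
  refine ⟨r, (le_max_right _ _).trans_lt hr1, hr2, ?_⟩
  have hr0 : 0 < r := (le_max_right _ _).trans_lt hr1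
  filter_upwards [eventually_lt_of_limsup_lt ((le_max_left _ _).trans_lt hr1) hbdd,
    eventually_gt_atTop 0] with n hn hn0
  have hn' : (n : ℝ) ≠ 0 := by exact_mod_cast hn0.ne'
  calc ∏ i ∈ Finset.range n, lam (s i)
      = ((∏ i ∈ Finset.range n, lam (s i)) ^ ((n : ℝ)⁻¹)) ^ n := by
        rw [← Real.rpow_natCast, Real.rpow_inv_rpow (hp0 n) hn']
    _ ≤ r ^ n := pow_le_pow_left₀ (Real.rpow_nonneg (hp0 n) _) hn.le n

end path
section pathmain

variable {E F : Type*} [MeasurableSpace E] [MeasurableSpace F]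

/-- contraction rates -/
def rhoS (m : ℕ) : ℝ := 1 - 1 / ((m : ℝ) + 2)

/-- minorization levels -/
def betS (j : ℕ) : ℝ := 1 / ((j : ℝ) + 2)

lemma rhoS_pos (m : ℕ) : 0 < rhoS m := by
  have : (1 : ℝ) / (m + 2) < 1 := by
    rw [div_lt_one (by positivity)]
    have : (0 : ℝ) ≤ m := m.cast_nonneg
    linarith
  unfold rhoS; linarith

lemma rhoS_lt (m : ℕ) : rhoS m < 1 := by
  have : (0 : ℝ) < 1 / (m + 2) := by positivity
  unfold rhoS; linarith

lemma betS_pos (j : ℕ) : 0 < betS j := by unfold betS; positivity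

lemma betS_lt (j : ℕ) : betS j < 1 := by
  unfold betS
  rw [div_lt_one (by positivity)]
  have : (0 : ℝ) ≤ j := j.cast_nonneg
  linarith

lemma betS_anti : Antitone betS := by
  intro i j h
  unfold betS
  gcongr

lemma betS_tendsto : Tendsto betS atTop (nhds 0) := by
  have := (tendsto_add_atTop_iff_nat 1).2 (tendsto_one_div_add_atTop_nhds_zero_nat (𝕜 := ℝ))
  refine this.congr fun n => ?_
  unfold betS; push_cast; ring_nf

/-- minorization constant along the path -/
def hS (lam b : F → ℝ) (η : ℝ → F → ℝ) (m : ℕ) (s : ℕ → F) : ℝ :=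
  η (8 / (1 - rhoS m) * (Qf lam b (rhoS m) (sh s)).toReal) (s 0)

/-- good sets -/
def GD (lam b : F → ℝ) (η : ℝ → F → ℝ) (m j : ℕ) : Set (ℕ → F) :=
  {s | betS j ≤ (1 - rhoS m) / 2 ∧ (∀ n, Qf lam b (rhoS m) (sh^[n] s) < ∞) ∧
    ∀ n, 4 * badCount (fun k => hS lam b η m (sh^[k] s) < 2 * betS j) n ≤ n}

lemma hS_measurable {lam b : F → ℝ} {η : ℝ → F → ℝ} (hlam : Measurable lam) (hb : Measurable b)
    (hη : Measurable fun p : ℝ × F => η p.1 p.2) (m : ℕ) : Measurable (hS lam b η m) := by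
  have : Measurable fun s : ℕ → F =>
      ((8 / (1 - rhoS m) * (Qf lam b (rhoS m) (sh s)).toReal, s 0) : ℝ × F) :=
    ((((Qf_measurable hlam hb _).comp sh_measurable).ennreal_toReal).const_mul _).prodMk
      (measurable_pi_apply 0)
  exact hη.comp this

lemma sh_iter_measurable (n : ℕ) : Measurable (sh^[n] : (ℕ → F) → (ℕ → F)) :=
  sh_measurable.iterate n

lemma GD_measurable {lam b : F → ℝ} {η : ℝ → F → ℝ} (hlam : Measurable lam) (hb : Measurable b)
    (hη : Measurable fun p : ℝ × F => η p.1 p.2) (m j : ℕ) :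
    MeasurableSet (GD lam b η m j) := by
  classical
  have e : GD lam b η m j = {_s | betS j ≤ (1 - rhoS m) / 2} ∩
      ((⋂ n, {s | Qf lam b (rhoS m) (sh^[n] s) < ∞}) ∩
      ⋂ n, {s | 4 * badCount (fun k => hS lam b η m (sh^[k] s) < 2 * betS j) n ≤ n}) := by
    ext s; simp [GD]
  rw [e]
  refine MeasurableSet.inter (MeasurableSet.const _) (MeasurableSet.inter ?_ ?_)
  · exact MeasurableSet.iInter fun n =>
      measurableSet_lt ((Qf_measurable hlam hb _).comp (sh_iter_measurable n)) measurable_const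
  · refine MeasurableSet.iInter fun n => measurableSet_le ?_ measurable_const
    refine Measurable.const_mul ?_ 4
    unfold badCount
    refine Finset.measurable_sum _ fun k _ => ?_
    refine Measurable.ite ?_ measurable_const measurable_const
    exact measurableSet_lt ((hS_measurable hlam hb hη m).comp (sh_iter_measurable k))
      measurable_const

lemma GD_limit [Nonempty E] (P : Kernel (F × E) E) [IsMarkovKernel P]
    (V : E → ℝ) (hVmeas : Measurable V) (hVpos : ∀ y, 0 < V y)
    (lam b : F → ℝ) (hlam0 : ∀ x, 0 ≤ lam x) (hb0 : ∀ x, 0 ≤ b x)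
    (hdrift : ∀ (x : F) (y : E), ∫⁻ z, ENNReal.ofReal (V z) ∂(P (x, y)) ≤
      ENNReal.ofReal (lam x) * ENNReal.ofReal (V y) + ENNReal.ofReal (b x))
    (η : ℝ → F → ℝ)
    (hsmall : ∀ R > (0 : ℝ), ∃ ν : Kernel F E, IsMarkovKernel ν ∧
      ∀ (x : F) (y : E) (A : Set E), MeasurableSet A → V y ≤ R →
        ENNReal.ofReal (η R x) * ν x A ≤ P (x, y) A)
    {m j : ℕ} {s : ℕ → F} (hs : s ∈ GD lam b η m j) :
    ∃ p : Measure E, IsProbabilityMeasure p ∧ ∀ z A n, MeasurableSet A →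
      |gf P A s n z - p.real A| ≤
        3 * (1 + V z) * √(1 - betS j) ^ n / (1 - √(1 - betS j)) := by
  obtain ⟨h1, h2, h3⟩ := hs
  have s0 : ∀ n, (sh^[n] s) 0 = s n := fun n => by rw [sh_iter, zero_add]
  have e1 : ∀ n, sh (sh^[n] s) = sh^[n + 1] s := fun n =>
    (Function.iterate_succ_apply' sh n s).symm
  refine det_main P V hVmeas hVpos lam b hlam0 hb0 hdrift η hsmall s
    (fun n => (Qf lam b (rhoS m) (sh^[n] s)).toReal) (ρ := rhoS m) (β := betS j)
    (R := 8 / (1 - rhoS m)) (rhoS_pos m) (rhoS_lt m) (betS_pos j) h1 rfl ?_ ?_ ?_ ?_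
  · intro n
    have := ENNReal.toReal_mono (h2 n).ne (one_le_Qf lam b (rhoS m) (sh^[n] s))
    simpa using this
  · intro n
    have := ENNReal.toReal_mono (h2 n).ne (b_le_Qf lam b (rhoS m) (sh^[n] s))
    rwa [ENNReal.toReal_ofReal (hb0 _), s0] at this
  · intro n
    have := ENNReal.toReal_mono (h2 n).ne (Qf_lam lam b hlam0 (rhoS_pos m) (sh^[n] s))
    rw [ENNReal.toReal_mul, s0, e1, ENNReal.toReal_ofReal
      (mul_nonneg (inv_nonneg.2 (rhoS_pos m).le) (hlam0 _)), mul_assoc,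
      inv_mul_le_iff₀ (rhoS_pos m)] at this
    exact this
  · intro n
    have := h3 n
    simp only [hS, s0, e1] at this
    exact this

lemma GD_ae {μ : Measure (ℕ → F)} [IsProbabilityMeasure μ] (hσ : MeasurePreserving sh μ μ)
    {lam b : F → ℝ} (hlam : Measurable lam) (hb : Measurable b)
    (hlam0 : ∀ x, 0 ≤ lam x)
    (hil : Integrable (fun s : ℕ → F => Real.log (max (lam (s 0)) 1)) μ)
    (hib : Integrable (fun s : ℕ → F => Real.log (max (b (s 0)) 1)) μ)
    (hlyap : ∀ᵐ s ∂μ, atTop.limsup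
      (fun n : ℕ => (∏ i ∈ Finset.range n, lam (s i)) ^ ((n : ℝ)⁻¹)) < 1)
    {η : ℝ → F → ℝ} (hη : Measurable fun p : ℝ × F => η p.1 p.2)
    (hη01 : ∀ R > (0 : ℝ), ∀ x, η R x ∈ Set.Ioo (0 : ℝ) 1) :
    ∀ᵐ s ∂μ, ∃ m j, s ∈ GD lam b η m j := by
  have s0 : ∀ n (s : ℕ → F), (sh^[n] s) 0 = s n := fun n s => by rw [sh_iter, zero_add]
  have hml : Measurable (fun s : ℕ → F => Real.log (max (lam (s 0)) 1)) :=
    Real.measurable_log.comp ((hlam.comp (measurable_pi_apply 0)).max measurable_const)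
  have hmb : Measurable (fun s : ℕ → F => Real.log (max (b (s 0)) 1)) :=
    Real.measurable_log.comp ((hb.comp (measurable_pi_apply 0)).max measurable_const)
  have hbd := ae_bdd hσ hml hil fun s => Real.log_nonneg (le_max_right _ _)
  have hsub := ae_sublinear hσ hmb hib fun s => Real.log_nonneg (le_max_right _ _)
  have hinv : ∀ᵐ s ∂μ, ∀ m, Qf lam b (rhoS m) s < ∞ →
      ∀ n, Qf lam b (rhoS m) (sh^[n] s) < ∞ := ae_all_iff.2 fun m =>
    ae_forward_inv hσ (C := {s | Qf lam b (rhoS m) s < ∞})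
      (measurableSet_lt (Qf_measurable hlam hb _) measurable_const)
      (fun s hs => Qf_lt_top lam b hlam0 (rhoS_pos m) s hs)
  have hj0 : ∀ m, ∃ j0, ∀ j ≥ j0, betS j ≤ (1 - rhoS m) / 2 := fun m => by
    have := betS_tendsto.eventually (eventually_le_nhds
      (show (0 : ℝ) < (1 - rhoS m) / 2 by linarith [rhoS_lt m]))
    exact eventually_atTop.1 this
  choose j0 hj0 using hj0
  have hden : ∀ᵐ s ∂μ, ∀ m, ∃ j ≥ j0 m, ∀ n, 4 * badCount (fun k => sh^[k] s ∈
      {s | Qf lam b (rhoS m) (sh s) < ∞ ∧ hS lam b η m s < 2 * betS j}) n ≤ n := by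
    refine ae_all_iff.2 fun m => ae_density hσ
      (fun j => {s | Qf lam b (rhoS m) (sh s) < ∞ ∧ hS lam b η m s < 2 * betS j})
      (fun j => ?_) ?_ ?_ (j0 m)
    · exact (measurableSet_lt ((Qf_measurable hlam hb _).comp sh_measurable)
        measurable_const).inter (measurableSet_lt (hS_measurable hlam hb hη m) measurable_const)
    · intro i j hij s hs
      exact ⟨hs.1, hs.2.trans_le (by linarith [betS_anti hij])⟩
    · rw [Set.eq_empty_iff_forall_notMem]
      intro s hs
      rw [Set.mem_iInter] at hs
      have hq : Qf lam b (rhoS m) (sh s) < ∞ := (hs 0).1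
      have hq1 : 1 ≤ (Qf lam b (rhoS m) (sh s)).toReal := by
        simpa using ENNReal.toReal_mono hq.ne (one_le_Qf lam b (rhoS m) (sh s))
      have hpos : 0 < hS lam b η m s :=
        (hη01 _ (mul_pos (div_pos (by norm_num) (by linarith [rhoS_lt m])) (by linarith)) _).1
      have ht : Tendsto (fun j => 2 * betS j) atTop (nhds 0) := by
        simpa using betS_tendsto.const_mul 2
      obtain ⟨j, hj⟩ := (ht.eventually (eventually_lt_nhds hpos)).exists
      exact absurd (hs j).2 (not_lt.2 hj.le)
  filter_upwards [hbd, hsub, hinv, hden, hlyap] with s h1 h2 h3 h4 h5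
  obtain ⟨K, hK⟩ := h1
  obtain ⟨r, hr0, hr1, hr⟩ := prod_growth hlam0 (s := s) (K := K) (fun n => by
    have := hK n
    simpa only [birkhoffSum, s0] using this) h5
  have hm : ∃ m, r < rhoS m := by
    obtain ⟨m, hm⟩ := (betS_tendsto.eventually (eventually_lt_nhds (sub_pos.2 hr1))).exists
    refine ⟨m, ?_⟩
    have e : rhoS m = 1 - betS m := rfl
    linarith
  obtain ⟨m, hm⟩ := hm
  have hfin : Qf lam b (rhoS m) s < ∞ := Qf_finite_of_growth hlam0 hr0 hm hr (fun j => by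
    have := h2 j
    simpa only [s0] using this)
  have hall := h3 m hfin
  obtain ⟨j, hj, hjn⟩ := h4 m
  refine ⟨m, j, hj0 m j hj, hall, fun n => ?_⟩
  have e : (fun k => sh^[k] s ∈
      {s | Qf lam b (rhoS m) (sh s) < ∞ ∧ hS lam b η m s < 2 * betS j})
      = fun k => hS lam b η m (sh^[k] s) < 2 * betS j := by
    funext k
    have h : Qf lam b (rhoS m) (sh (sh^[k] s)) < ∞ := by
      rw [← Function.iterate_succ_apply' sh k s]; exact hall (k + 1)
    simp [h]
  rw [← e]
  exact hjn n

/-- abstract assembly -/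
lemma path_main [Nonempty E] (P : Kernel (F × E) E) [IsMarkovKernel P]
    (V : E → ℝ) (μ : Measure (ℕ → F)) (D : ℕ → Set (ℕ → F)) (hD : ∀ N, MeasurableSet (D N))
    (hae : ∀ᵐ s ∂μ, ∃ N, s ∈ D N) (k : ℕ → ℝ) (hk : ∀ N, k N ∈ Set.Ioo (0 : ℝ) 1)
    (hlim : ∀ N, ∀ s ∈ D N, ∃ p : Measure E, IsProbabilityMeasure p ∧ ∀ z A n, MeasurableSet A →
      |gf P A s n z - p.real A| ≤ 3 * (1 + V z) * k N ^ n / (1 - k N)) :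
    ∃ π : Kernel (ℕ → F) E, IsMarkovKernel π ∧ ∃ Fc κ : (ℕ → F) → ℝ,
      Measurable Fc ∧ Measurable κ ∧ (∀ s, 0 < Fc s) ∧ (∀ s, κ s ∈ Set.Ioo (0 : ℝ) 1) ∧
      ∀ᵐ s ∂μ, ∀ z A n, MeasurableSet A →
        |gf P A s n z - (π s).real A| ≤ Fc s * (1 + V z) * κ s ^ n := by
  classical
  obtain ⟨z0⟩ := ‹Nonempty E›
  have hU : MeasurableSet (⋃ N, D N) := MeasurableSet.iUnion hD
  have hex : ∀ s, ∃ N, s ∈ D N ∨ s ∉ ⋃ N, D N := by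
    intro s
    by_cases h : s ∈ ⋃ N, D N
    · obtain ⟨N, hN⟩ := Set.mem_iUnion.1 h
      exact ⟨N, Or.inl hN⟩
    · exact ⟨0, Or.inr h⟩
  have hidx : Measurable fun s => Nat.find (hex s) :=
    measurable_find hex fun N => (hD N).union hU.compl
  have hidxD : ∀ s ∈ ⋃ N, D N, s ∈ D (Nat.find (hex s)) := fun s hs =>
    (Nat.find_spec (hex s)).resolve_right (not_not.2 hs)
  have hchoose : ∀ s, ∃ p : Measure E, IsProbabilityMeasure p ∧
      (s ∈ ⋃ N, D N → ∀ z A n, MeasurableSet A → |gf P A s n z - p.real A| ≤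
        3 * (1 + V z) * k (Nat.find (hex s)) ^ n / (1 - k (Nat.find (hex s)))) ∧
      (s ∉ ⋃ N, D N → p = Measure.dirac z0) := by
    intro s
    by_cases h : s ∈ ⋃ N, D N
    · obtain ⟨p, hp1, hp2⟩ := hlim _ s (hidxD s h)
      exact ⟨p, hp1, fun _ => hp2, fun h' => absurd h h'⟩
    · exact ⟨Measure.dirac z0, inferInstance, fun h' => absurd h' h, fun _ => rfl⟩
  choose p hp1 hp2 hp3 using hchoose
  have hmeas : Measurable p := by
    refine Measure.measurable_of_measurable_coe _ fun A hA => ?_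
    have hg : ∀ n, Measurable fun s : ℕ → F =>
        if s ∈ ⋃ N, D N then ef P A (bl s n) z0 else Measure.dirac z0 A := fun n =>
      Measurable.ite hU ((ef_bl_measurable P hA n).comp measurable_prodMk_right) measurable_const
    refine measurable_of_tendsto_metrizable hg (tendsto_pi_nhds.2 fun s => ?_)
    by_cases h : s ∈ ⋃ N, D N
    · simp only [h, if_true]
      have hkN := hk (Nat.find (hex s))
      have ht : Tendsto (fun n => gf P A s n z0) atTop (nhds ((p s).real A)) := by
        rw [tendsto_iff_norm_sub_tendsto_zero]
        refine squeeze_zero (fun n => norm_nonneg _) (fun n => hp2 s h z0 A n hA) ?_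
        have := (tendsto_pow_atTop_nhds_zero_of_lt_one hkN.1.le hkN.2).const_mul
          (3 * (1 + V z0))
        simpa using this.div_const (1 - k (Nat.find (hex s)))
      have h2 := ENNReal.tendsto_ofReal ht
      have hps := hp1 s
      rw [ofReal_measureReal] at h2
      refine h2.congr fun n => ?_
      rw [gf, ENNReal.ofReal_toReal (ne_top_of_le_ne_top ENNReal.one_ne_top (ef_le_one P A _ _))]
    · simp [h, hp3 s h]
  refine ⟨⟨p, hmeas⟩, ⟨hp1⟩, fun s => 3 / (1 - k (Nat.find (hex s))),
    fun s => k (Nat.find (hex s)), ?_, ?_, ?_, fun s => hk _, ?_⟩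
  · exact (measurable_from_nat (f := fun N => 3 / (1 - k N))).comp hidx
  · exact (measurable_from_nat (f := k)).comp hidx
  · intro s
    exact div_pos (by norm_num) (by linarith [(hk (Nat.find (hex s))).2])
  · filter_upwards [hae] with s hs z A n hA
    refine (hp2 s (Set.mem_iUnion.2 hs) z A n hA).trans (le_of_eq ?_)
    ring

end pathmain
theorem backward_iterations_converge_geometrically
    {E F : Type*}
    [MeasurableSpace E] [TopologicalSpace E] [PolishSpace E] [BorelSpace E]
    [MeasurableSpace F] [TopologicalSpace F] [PolishSpace F] [BorelSpace F]
    {Ω : Type*} [MeasurableSpace Ω] (Pr : Measure Ω) [IsProbabilityMeasure Pr]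
    (X : ℤ → Ω → F) (hX : ∀ t, Measurable (X t))
    (P : Kernel (F × E) E) [IsMarkovKernel P]
    -- A1 : the environment is stationary
    (hstat : (Pr.map fun ω => fun t => X t ω).map zshift = Pr.map fun ω => fun t => X t ω)
    -- A2 : drift condition with random coefficients
    (V : E → ℝ) (hVmeas : Measurable V) (hVpos : ∀ y, 0 < V y)
    (lam b : F → ℝ) (hlam : Measurable lam) (hb : Measurable b)
    (hlam0 : ∀ x, 0 ≤ lam x) (hb0 : ∀ x, 0 ≤ b x)
    (hlamlog : ∫⁻ ω, ENNReal.ofReal (Real.log (max (lam (X 0 ω)) 1)) ∂Pr < ∞)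
    (hblog : ∫⁻ ω, ENNReal.ofReal (Real.log (max (b (X 0 ω)) 1)) ∂Pr < ∞)
    (hdrift : ∀ (x : F) (y : E), ∫⁻ z, ENNReal.ofReal (V z) ∂(P (x, y)) ≤
      ENNReal.ofReal (lam x) * ENNReal.ofReal (V y) + ENNReal.ofReal (b x))
    (hlyap : ∀ᵐ ω ∂Pr, atTop.limsup
      (fun n : ℕ => (∏ i ∈ Finset.range n, lam (X (-(i : ℤ) - 1) ω)) ^ ((n : ℝ)⁻¹)) < 1)
    -- A3 : sublevel sets of V are small sets, uniformly in the environment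
    (η : ℝ → F → ℝ) (hηmeas : Measurable fun p : ℝ × F => η p.1 p.2)
    (hη01 : ∀ R > (0 : ℝ), ∀ x, η R x ∈ Set.Ioo (0 : ℝ) 1)
    (hsmall : ∀ R > (0 : ℝ), ∃ ν : Kernel F E, IsMarkovKernel ν ∧
      ∀ (x : F) (y : E) (A : Set E), MeasurableSet A → V y ≤ R →
        ENNReal.ofReal (η R x) * ν x A ≤ P (x, y) A) :
    -- there are a probability kernel `π` from `F^ℕ` to `E` and random variables
    -- `Fc : Ω → (0,∞)`, `κ : Ω → (0,1)` such that, a.s., for all `n ≥ 1`,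
    -- `d_TV(δ_z P_{X_{-n}} ⋯ P_{X_{-1}}, π_{ξ_{-1}}) ≤ Fc (1 + V(z)) κ^n`; in particular the
    -- backward iterations converge a.s. in total variation to `π_{ξ_{-1}}`.
    ∃ π : Kernel (ℕ → F) E, IsMarkovKernel π ∧
      ∃ Fc κ : Ω → ℝ, Measurable Fc ∧ Measurable κ ∧
        (∀ ω, 0 < Fc ω) ∧ (∀ ω, κ ω ∈ Set.Ioo (0 : ℝ) 1) ∧
        ∀ z : E, ∀ᵐ ω ∂Pr,
          (∀ n : ℕ, 1 ≤ n →
            dTV (iterFrom P ((List.range n).map fun i => X ((i : ℤ) - (n : ℤ)) ω)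
                (Measure.dirac z))
              (π fun j : ℕ => X (-1 - (j : ℤ)) ω) ≤
            ENNReal.ofReal (Fc ω * (1 + V z) * κ ω ^ n)) ∧
          Tendsto (fun n : ℕ =>
            dTV (iterFrom P ((List.range n).map fun i => X ((i : ℤ) - (n : ℤ)) ω)
                (Measure.dirac z))
              (π fun j : ℕ => X (-1 - (j : ℤ)) ω)) atTop (nhds 0) := by
  have hΩ : Nonempty Ω := nonempty_of_isProbabilityMeasure Pr
  obtain ⟨ω0⟩ := hΩ
  have hE : Nonempty E := by
    obtain ⟨ν, hν, -⟩ := hsmall 1 one_pos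
    exact nonempty_of_isProbabilityMeasure (ν (X 0 ω0))
  have hXm : Measurable fun ω => fun t => X t ω := measurable_pi_lambda _ hX
  have hzm : Measurable (zshift : (ℤ → F) → (ℤ → F)) :=
    measurable_pi_lambda _ fun t => measurable_pi_apply (t + 1)
  have hrm : Measurable fun (x : ℤ → F) => fun j : ℕ => x (-1 - (j : ℤ)) :=
    measurable_pi_lambda _ fun j => measurable_pi_apply _
  set r : (ℤ → F) → (ℕ → F) := fun x => fun j : ℕ => x (-1 - (j : ℤ)) with hr
  set ξ : Ω → (ℕ → F) := fun ω => fun j : ℕ => X (-1 - (j : ℤ)) ω with hξ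
  have hξm : Measurable ξ := measurable_pi_lambda _ fun j => hX _
  have hprob : IsProbabilityMeasure (Pr.map ξ) := Measure.isProbabilityMeasure_map hξm.aemeasurable
  have hμ : Pr.map ξ = (Pr.map fun ω => fun t => X t ω).map r := by
    rw [Measure.map_map hrm hXm]; rfl
  have hσ : MeasurePreserving sh (Pr.map ξ) (Pr.map ξ) := by
    refine ⟨sh_measurable, ?_⟩
    have e : sh ∘ r ∘ zshift = r := by
      funext x j
      simp only [Function.comp, sh, hr, zshift]
      congr 1
      push_cast; ring
    calc (Pr.map ξ).map sh
        = (((Pr.map fun ω => fun t => X t ω).map zshift).map r).map sh := by rw [hμ, hstat]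
      _ = (Pr.map fun ω => fun t => X t ω).map (sh ∘ r ∘ zshift) := by
          rw [Measure.map_map hrm hzm, Measure.map_map sh_measurable (hrm.comp hzm)]
      _ = Pr.map ξ := by rw [e, hμ]
  have hIntg : ∀ c : F → ℝ, Measurable c →
      ∫⁻ ω, ENNReal.ofReal (Real.log (max (c (X 0 ω)) 1)) ∂Pr < ∞ →
      Integrable (fun s : ℕ → F => Real.log (max (c (s 0)) 1)) (Pr.map ξ) := by
    intro c hc hlt
    have hmc : Measurable fun x : F => Real.log (max (c x) 1) :=
      Real.measurable_log.comp (hc.max measurable_const)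
    have hms : Measurable (fun s : ℕ → F => Real.log (max (c (s 0)) 1)) :=
      hmc.comp (measurable_pi_apply 0)
    refine (lintegral_ofReal_ne_top_iff_integrable hms.aestronglyMeasurable
      (Eventually.of_forall fun s => Real.log_nonneg (le_max_right _ _))).1 ?_
    have hG : ∀ t : ℤ, Measurable fun x : ℤ → F => ENNReal.ofReal (Real.log (max (c (x t)) 1)) :=
      fun t => (hmc.comp (measurable_pi_apply t)).ennreal_ofReal
    have e1 : ∫⁻ s, ENNReal.ofReal (Real.log (max (c (s 0)) 1)) ∂(Pr.map ξ)
        = ∫⁻ x, ENNReal.ofReal (Real.log (max (c (x (-1))) 1))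
          ∂(Pr.map fun ω => fun t => X t ω) := by
      rw [hμ, lintegral_map hms.ennreal_ofReal hrm]
      simp [hr]
    have e2 : ∫⁻ x, ENNReal.ofReal (Real.log (max (c (x (-1))) 1))
          ∂(Pr.map fun ω => fun t => X t ω)
        = ∫⁻ ω, ENNReal.ofReal (Real.log (max (c (X 0 ω)) 1)) ∂Pr := by
      rw [← hstat, lintegral_map (hG (-1)) hzm]
      simp only [zshift]
      norm_num
      rw [lintegral_map (hG 0) hXm]
    rw [e1, e2]
    exact hlt.ne
  have hly : ∀ᵐ s ∂(Pr.map ξ), atTop.limsup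
      (fun n : ℕ => (∏ i ∈ Finset.range n, lam (s i)) ^ ((n : ℝ)⁻¹)) < 1 := by
    rw [ae_map_iff hξm.aemeasurable]
    · filter_upwards [hlyap] with ω hω
      have e : ∀ i : ℕ, ξ ω i = X (-(i : ℤ) - 1) ω := fun i => by
        simp only [hξ]; congr 1; ring
      simp only [e]
      exact hω
    · refine measurableSet_lt (Measurable.limsup fun n => ?_) measurable_const
      exact (Finset.measurable_prod _ fun i _ => hlam.comp (measurable_pi_apply i)).pow_const _
  have hgd := GD_ae hσ hlam hb hlam0 (hIntg lam hlam hlamlog) (hIntg b hb hblog) hly hηmeas hη01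
  obtain ⟨π, hπ, Fc, κ, hFm, hκm, hF0, hκ, hmain⟩ := path_main P V (Pr.map ξ)
    (fun N => GD lam b η N.unpair.1 N.unpair.2)
    (fun N => GD_measurable hlam hb hηmeas _ _)
    (by
      filter_upwards [hgd] with s hs
      obtain ⟨m, j, h⟩ := hs
      exact ⟨Nat.pair m j, by simpa using h⟩)
    (fun N => √(1 - betS N.unpair.2))
    (fun N => ⟨Real.sqrt_pos.2 (by linarith [betS_lt N.unpair.2]),
      (Real.sqrt_lt' one_pos).2 (by linarith [betS_pos N.unpair.2])⟩)
    (fun N s hs => GD_limit P V hVmeas hVpos lam b hlam0 hb0 hdrift η hsmall hs)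
  refine ⟨π, hπ, fun ω => Fc (ξ ω), fun ω => κ (ξ ω), hFm.comp hξm, hκm.comp hξm,
    fun ω => hF0 _, fun ω => hκ _, fun z => ?_⟩
  filter_upwards [ae_of_ae_map hξm.aemeasurable hmain] with ω hω
  have hlist : ∀ n : ℕ, ((List.range n).map fun i : ℕ => X ((i : ℤ) - (n : ℤ)) ω)
      = bl (ξ ω) n := by
    intro n
    induction n with
    | zero => rfl
    | succ n ih =>
      rw [List.range_succ_eq_map, List.map_cons, List.map_map, bl, ← ih]
      congr 1
      · simp only [hξ]
        congr 1
        push_cast; ring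
      · refine List.map_congr_left fun i _ => ?_
        simp only [Function.comp]
        congr 1
        push_cast; ring
  have hbound : ∀ n : ℕ,
      dTV (iterFrom P ((List.range n).map fun i => X ((i : ℤ) - (n : ℤ)) ω)
        (Measure.dirac z)) (π (ξ ω)) ≤ ENNReal.ofReal (Fc (ξ ω) * (1 + V z) * κ (ξ ω) ^ n) := by
    intro n
    have hl2 : ((List.range n).map fun i => X ((i : ℤ) - (n : ℤ)) ω) = bl (ξ ω) n := by
      rw [← hlist n]
      have e : ∀ l : List ℕ, l.flatMap (fun a : ℕ => [(a : ℤ)]) = l.map (fun a : ℕ => (a : ℤ)) := by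
        intro l
        induction l with
        | nil => rfl
        | cons a l ih => simp [ih]
      simp [e]
    rw [hl2]
    refine iSup_le fun A => iSup_le fun hA => ?_
    have h := hω z A n hA
    rw [iterFrom_dirac P hA]
    have e1 : ef P A (bl (ξ ω) n) z = ENNReal.ofReal (gf P A (ξ ω) n z) := by
      rw [gf, ENNReal.ofReal_toReal (ne_top_of_le_ne_top ENNReal.one_ne_top (ef_le_one P A _ _))]
    have e2 : π (ξ ω) A = ENNReal.ofReal ((π (ξ ω)).real A) := by
      rw [ofReal_measureReal]
    rw [abs_le] at h
    rw [e1, e2, ← ENNReal.ofReal_sub _ measureReal_nonneg,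
      ← ENNReal.ofReal_sub _ (gf_nonneg P A _ _ _)]
    exact max_le (ENNReal.ofReal_le_ofReal (by linarith))
      (ENNReal.ofReal_le_ofReal (by linarith))
  refine ⟨fun n _ => hbound n, ?_⟩
  have ht : Tendsto (fun n => ENNReal.ofReal (Fc (ξ ω) * (1 + V z) * κ (ξ ω) ^ n))
      atTop (nhds 0) := by
    have := (tendsto_pow_atTop_nhds_zero_of_lt_one (hκ (ξ ω)).1.le (hκ (ξ ω)).2).const_mul
      (Fc (ξ ω) * (1 + V z))
    rw [mul_zero] at this
    simpa using ENNReal.tendsto_ofReal this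
  exact tendsto_of_tendsto_of_tendsto_of_le_of_le tendsto_const_nhds ht
    (fun n => zero_le) hbound

end
end

section
/- Suppose Assumptions A1–A3 hold and let π be the probability kernel from F^ℕ to E such that, for each t ∈ ℤ and each z ∈ E, π_{ξ_t} is the ℙ-a.s. total-variation limit of δ_z P_{X_{t-n}} ⋯ P_{X_t} as n → ∞, where ξ_t = (X_{t-j})_{j≥0}. Then for every t ∈ ℤ, ℙ-almost surely, π_{ξ_{t-1}} P_{X_t} = π_{ξ_t}, where (μ P_x)(A) = ∫ μ(dy) P_x(y,A); that is, the family (π_{ξ_t})_{t∈ℤ} is randomly invariant for the random kernels. -/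
open MeasureTheory ProbabilityTheory Filter
open scoped ENNReal

noncomputable section

theorem dTV_comm' {E : Type*} [MeasurableSpace E] (μ ν : Measure E) : dTV μ ν = dTV ν μ := by
  unfold dTV
  simp_rw [max_comm]

theorem le_add_dTV {E : Type*} [MeasurableSpace E] (μ ν : Measure E) {A : Set E}
    (hA : MeasurableSet A) : μ A ≤ ν A + dTV μ ν := by
  have h : μ A - ν A ≤ dTV μ ν := by
    unfold dTV
    exact le_trans (le_max_left _ (ν A - μ A))
      (le_iSup₂ (f := fun (A : Set E) (_ : MeasurableSet A) => max (μ A - ν A) (ν A - μ A)) A hA)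
  exact tsub_le_iff_left.mp h

theorem lintegral_le_add_dTV {E : Type*} [MeasurableSpace E] (μ ν : Measure E)
    {f : E → ℝ≥0∞} (hf : Measurable f) (hf1 : ∀ y, f y ≤ 1) :
    ∫⁻ y, f y ∂μ ≤ (∫⁻ y, f y ∂ν) + dTV μ ν := by
  have hfm : Measurable fun y => (f y).toReal := hf.ennreal_toReal
  have key : ∀ ρ : Measure E, ∫⁻ y, f y ∂ρ
      = ∫⁻ t in Set.Ioi (0 : ℝ), ρ {a | t < (f a).toReal} := by
    intro ρ
    rw [← lintegral_eq_lintegral_meas_lt ρ (Eventually.of_forall fun y => ENNReal.toReal_nonneg)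
      hfm.aemeasurable]
    refine lintegral_congr fun y => ?_
    rw [ENNReal.ofReal_toReal (ne_top_of_le_ne_top ENNReal.one_ne_top (hf1 y))]
  rw [key μ, key ν]
  have hind : Measurable ((Set.Iio (1 : ℝ)).indicator fun _ => dTV μ ν) :=
    measurable_const.indicator measurableSet_Iio
  calc ∫⁻ t in Set.Ioi (0 : ℝ), μ {a | t < (f a).toReal}
      ≤ ∫⁻ t in Set.Ioi (0 : ℝ), (ν {a | t < (f a).toReal}
          + (Set.Iio (1 : ℝ)).indicator (fun _ => dTV μ ν) t) := by
        refine lintegral_mono fun t => ?_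
        by_cases ht : t < 1
        · rw [Set.indicator_of_mem (show t ∈ Set.Iio (1 : ℝ) from ht)]
          exact le_add_dTV μ ν (measurableSet_lt measurable_const hfm)
        · have : {a | t < (f a).toReal} = ∅ := by
            ext a
            simp only [Set.mem_ofPred_eq, Set.mem_empty_iff_false, iff_false, not_lt]
            refine le_trans ?_ (not_lt.mp ht)
            simpa using ENNReal.toReal_mono ENNReal.one_ne_top (hf1 a)
          simp [this]
    _ = (∫⁻ t in Set.Ioi (0 : ℝ), ν {a | t < (f a).toReal}) + dTV μ ν := by
        rw [lintegral_add_right _ hind, lintegral_indicator measurableSet_Iio,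
          Measure.restrict_restrict measurableSet_Iio]
        simp [Set.Iio_inter_Ioi]

theorem stepMeas_apply' {E F : Type*} [MeasurableSpace E] [MeasurableSpace F]
    (P : Kernel (F × E) E) (x : F) (μ : Measure E) {A : Set E} (hA : MeasurableSet A) :
    stepMeas P x μ A = ∫⁻ y, P (x, y) A ∂μ :=
  Measure.bind_apply hA (P.measurable.comp measurable_prodMk_left).aemeasurable

theorem stepMeas_le {E F : Type*} [MeasurableSpace E] [MeasurableSpace F]
    (P : Kernel (F × E) E) [IsMarkovKernel P] (x : F) (μ ν : Measure E) {A : Set E}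
    (hA : MeasurableSet A) :
    stepMeas P x μ A ≤ stepMeas P x ν A + dTV μ ν := by
  rw [stepMeas_apply' P x μ hA, stepMeas_apply' P x ν hA]
  exact lintegral_le_add_dTV μ ν ((P.measurable_coe hA).comp measurable_prodMk_left)
    fun y => prob_le_one

theorem iterFrom_concat {E F : Type*} [MeasurableSpace E] [MeasurableSpace F]
    (P : Kernel (F × E) E) (x : F) (l : List F) : ∀ μ : Measure E,
    iterFrom P (l ++ [x]) μ = stepMeas P x (iterFrom P l μ) := by
  induction l with
  | nil => intro μ; rfl
  | cons a l ih => intro μ; exact ih _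

theorem stepMeas_eq_of_tendsto {E F : Type*} [MeasurableSpace E] [MeasurableSpace F]
    (P : Kernel (F × E) E) [IsMarkovKernel P] (x : F) (m : ℕ → Measure E) (μ ν : Measure E)
    (h2 : Tendsto (fun n => dTV (m n) μ) atTop (nhds 0))
    (h1 : Tendsto (fun n => dTV (stepMeas P x (m n)) ν) atTop (nhds 0)) :
    stepMeas P x μ = ν := by
  have hsum := h2.add h1
  rw [add_zero] at hsum
  ext A hA
  have lim : ∀ c : ℝ≥0∞, Tendsto
      (fun n => c + (dTV (m n) μ + dTV (stepMeas P x (m n)) ν)) atTop (nhds c) := by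
    intro c
    have h := (tendsto_const_nhds (x := c)).add hsum
    rwa [add_zero] at h
  apply le_antisymm
  · refine ge_of_tendsto' (lim _) (fun n => ?_)
    calc stepMeas P x μ A ≤ stepMeas P x (m n) A + dTV μ (m n) := stepMeas_le P x _ _ hA
      _ ≤ (ν A + dTV (stepMeas P x (m n)) ν) + dTV μ (m n) := by
        gcongr
        exact le_add_dTV _ _ hA
      _ = ν A + (dTV (m n) μ + dTV (stepMeas P x (m n)) ν) := by
        rw [dTV_comm' μ (m n), add_assoc, add_comm (dTV (stepMeas P x (m n)) ν)]
  · refine ge_of_tendsto' (lim _) (fun n => ?_)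
    calc ν A ≤ stepMeas P x (m n) A + dTV ν (stepMeas P x (m n)) := le_add_dTV _ _ hA
      _ ≤ (stepMeas P x μ A + dTV (m n) μ) + dTV ν (stepMeas P x (m n)) := by
        gcongr
        exact stepMeas_le P x _ _ hA
      _ = stepMeas P x μ A + (dTV (m n) μ + dTV (stepMeas P x (m n)) ν) := by
        rw [dTV_comm' ν, add_assoc]

theorem randomly_invariant_measures
    {E F : Type*}
    [MeasurableSpace E] [TopologicalSpace E] [PolishSpace E] [BorelSpace E]
    [MeasurableSpace F] [TopologicalSpace F] [PolishSpace F] [BorelSpace F]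
    {Ω : Type*} [MeasurableSpace Ω] (Pr : Measure Ω) [IsProbabilityMeasure Pr]
    (X : ℤ → Ω → F) (hX : ∀ t, Measurable (X t))
    (P : Kernel (F × E) E) [IsMarkovKernel P]
    -- A1 : the environment is stationary
    (hstat : (Pr.map fun ω => fun t => X t ω).map zshift = Pr.map fun ω => fun t => X t ω)
    -- A2 : drift condition with random coefficients
    (V : E → ℝ) (hVmeas : Measurable V) (hVpos : ∀ y, 0 < V y)
    (lam b : F → ℝ) (hlam : Measurable lam) (hb : Measurable b)
    (hlam0 : ∀ x, 0 ≤ lam x) (hb0 : ∀ x, 0 ≤ b x)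
    (hlamlog : ∫⁻ ω, ENNReal.ofReal (Real.log (max (lam (X 0 ω)) 1)) ∂Pr < ∞)
    (hblog : ∫⁻ ω, ENNReal.ofReal (Real.log (max (b (X 0 ω)) 1)) ∂Pr < ∞)
    (hdrift : ∀ (x : F) (y : E), ∫⁻ z, ENNReal.ofReal (V z) ∂(P (x, y)) ≤
      ENNReal.ofReal (lam x) * ENNReal.ofReal (V y) + ENNReal.ofReal (b x))
    (hlyap : ∀ᵐ ω ∂Pr, atTop.limsup
      (fun n : ℕ => (∏ i ∈ Finset.range n, lam (X (-(i : ℤ) - 1) ω)) ^ ((n : ℝ)⁻¹)) < 1)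
    -- A3 : sublevel sets of V are small sets, uniformly in the environment
    (η : ℝ → F → ℝ) (hηmeas : Measurable fun p : ℝ × F => η p.1 p.2)
    (hη01 : ∀ R > (0 : ℝ), ∀ x, η R x ∈ Set.Ioo (0 : ℝ) 1)
    (hsmall : ∀ R > (0 : ℝ), ∃ ν : Kernel F E, IsMarkovKernel ν ∧
      ∀ (x : F) (y : E) (A : Set E), MeasurableSet A → V y ≤ R →
        ENNReal.ofReal (η R x) * ν x A ≤ P (x, y) A)
    -- `π` is the probability kernel from `F^ℕ` to `E` whose value at `ξ_t` is the a.s.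
    -- total-variation limit of the backward iterations `δ_z P_{X_{t-n}} ⋯ P_{X_t}`
    (π : Kernel (ℕ → F) E) [IsMarkovKernel π]
    (hπ : ∀ (t : ℤ) (z : E), ∀ᵐ ω ∂Pr,
      Tendsto (fun n : ℕ =>
        dTV (iterFrom P ((List.range (n + 1)).map fun i => X (t - (n : ℤ) + (i : ℤ)) ω)
            (Measure.dirac z))
          (π fun j : ℕ => X (t - (j : ℤ)) ω)) atTop (nhds 0)) :
    -- random invariance: π_{ξ_{t-1}} P_{X_t} = π_{ξ_t} a.s.
    ∀ t : ℤ, ∀ᵐ ω ∂Pr,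
      stepMeas P (X t ω) (π fun j : ℕ => X (t - 1 - (j : ℤ)) ω) =
        π fun j : ℕ => X (t - (j : ℤ)) ω := by
  intro t
  have hΩ : Nonempty Ω := nonempty_of_isProbabilityMeasure Pr
  obtain ⟨ω₀⟩ := hΩ
  have hE : Nonempty E :=
    nonempty_of_isProbabilityMeasure (π fun j : ℕ => X (t - (j : ℤ)) ω₀)
  obtain ⟨z⟩ := hE
  filter_upwards [hπ t z, hπ (t - 1) z] with ω h1 h2
  have h1' := (tendsto_add_atTop_iff_nat 1).mpr h1
  have hiter : ∀ n : ℕ,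
      iterFrom P ((List.range (n + 1 + 1)).map fun i => X (t - ((n + 1 : ℕ) : ℤ) + (i : ℤ)) ω)
        (Measure.dirac z) =
      stepMeas P (X t ω) (iterFrom P
        ((List.range (n + 1)).map fun i => X (t - 1 - (n : ℤ) + (i : ℤ)) ω)
        (Measure.dirac z)) := by
    intro n
    have hdo : ∀ l : List ℕ, (do let a ← l; pure (a : ℤ)) = l.map (fun a : ℕ => (a : ℤ)) := by
      intro l
      exact bind_pure_comp _ l
    rw [hdo, hdo, List.map_map, List.map_map,
      List.range_succ, List.map_append, List.map_singleton, iterFrom_concat]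
    simp only [Function.comp_def]
    have e1 : t - ((n + 1 : ℕ) : ℤ) + ((n + 1 : ℕ) : ℤ) = t := by ring
    have e2 : ∀ i : ℕ, t - ((n + 1 : ℕ) : ℤ) + (i : ℤ) = t - 1 - (n : ℤ) + (i : ℤ) := by
      intro i; push_cast; ring
    rw [e1]
    simp_rw [e2]
  simp_rw [hiter] at h1'
  exact stepMeas_eq_of_tendsto P (X t ω) _ _ _ h2 h1'

end
end

section
/- Consider the functional-coefficient model with p = 2: let a_1, a_2 : ℝ^d × ℝ^2 → ℝ be measurable with finite envelopes b_j(x) = sup_{y_1,y_2} |a_j(x,y_1,y_2)|, let g(x,y_1,y_2) = a_1(x,y_1,y_2)y_1 + a_2(x,y_1,y_2)y_2, let f be a probability density on ℝ with ∫|u| f(u) du < ∞, and define the Markov kernel on ℝ^2 by P_x((y_1,y_2), A) = ∫ 1_A(g(x,y_1,y_2) + u, y_1) f(u) du. Let V(y_1,y_2) = |y_1| + |y_2|, let A(x) be the 2×2 matrix with rows (b_1(x), b_2(x)) and (1, 0), let ‖·‖ denote the ℓ¹ operator norm, and let c = (∫|u| f(u) du, 0)ᵗ. Then for every k ≥ 1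 and all x_1, …, x_k ∈ ℝ^d, (P_{x_1} ⋯ P_{x_k}) V ≤ ‖A(x_k) ⋯ A(x_1)‖ · V + b(x_k,…,x_1), where b(x_k,…,x_1) = ‖c‖ + Σ_{j=2}^k ‖A(x_k)‖ ⋯ ‖A(x_{k-j+2})‖ · ‖c‖. -/
open MeasureTheory ProbabilityTheory Filter
open scoped ENNReal

noncomputable section

/-- The `2 × 2` companion matrix with first row `(b₁(x), b₂(x))`. -/
def compMat2 {d : ℕ} (bfun : Fin 2 → (Fin d → ℝ) → ℝ) (x : Fin d → ℝ) :
    Matrix (Fin 2) (Fin 2) ℝ :=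
  !![bfun 0 x, bfun 1 x; 1, 0]

/-- The `ℓ¹` operator norm of a `2 × 2` real matrix (maximal column sum of absolute values). -/
def l1OpNorm (M : Matrix (Fin 2) (Fin 2) ℝ) : ℝ :=
  max (|M 0 0| + |M 1 0|) (|M 0 1| + |M 1 1|)

lemma lintegral_P_eq {d : ℕ} (f : ℝ → ℝ) (hf : Measurable f)
    (P : Kernel ((Fin d → ℝ) × (ℝ × ℝ)) (ℝ × ℝ))
    (x : Fin d → ℝ) (y : ℝ × ℝ) (g : ℝ)
    (hP : ∀ (A : Set (ℝ × ℝ)), MeasurableSet A →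
      P (x, y) A = ∫⁻ u, A.indicator (fun _ => (1 : ℝ≥0∞)) (g + u, y.1) *
          ENNReal.ofReal (f u)) (h : ℝ × ℝ → ℝ≥0∞) (hh : Measurable h) :
    ∫⁻ z, h z ∂(P (x, y)) = ∫⁻ u, ENNReal.ofReal (f u) * h (g + u, y.1) := by
  have hT : Measurable (fun u : ℝ => (g + u, y.1)) := by fun_prop
  have hd : Measurable (fun u : ℝ => ENNReal.ofReal (f u)) := by fun_prop
  have e : P (x, y) = (volume.withDensity (fun u => ENNReal.ofReal (f u))).map
      (fun u : ℝ => (g + u, y.1)) := by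
    ext A hA
    rw [hP A hA, Measure.map_apply hT hA, withDensity_apply _ (hT hA),
      ← lintegral_indicator (hT hA)]
    refine lintegral_congr fun u => ?_
    by_cases hu : (g + u, y.1) ∈ A <;> simp [Set.indicator, hu]
  rw [e, lintegral_map hh hT]
  exact lintegral_withDensity_eq_lintegral_mul _ hd (hh.comp hT)

lemma iterFrom_append_single {E F : Type*} [MeasurableSpace E] [MeasurableSpace F]
    (P : Kernel (F × E) E) (L : List F) (x : F) (μ : Measure E) :
    iterFrom P (L ++ [x]) μ = stepMeas P x (iterFrom P L μ) := by
  induction L generalizing μ with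
  | nil => rfl
  | cons a L ih => exact ih _

lemma lintegral_stepMeas {E F : Type*} [MeasurableSpace E] [MeasurableSpace F]
    (P : Kernel (F × E) E) (x : F) (μ : Measure E) (h : E → ℝ≥0∞) (hh : Measurable h) :
    ∫⁻ z, h z ∂(stepMeas P x μ) = ∫⁻ y, ∫⁻ z, h z ∂(P (x, y)) ∂μ :=
  Measure.lintegral_bind (P.measurable.comp measurable_prodMk_left).aemeasurable
    hh.aemeasurable

lemma l1_ineq (p q u v : ℝ) (b0 b1 : ℝ) (h0 : 0 ≤ b0) (h1 : 0 ≤ b1) (hu : 0 ≤ u) (hv : 0 ≤ v)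
    (hp : 0 ≤ p) (hq : 0 ≤ q) :
    (b0 * u + b1 * v) + (p * u + q * v) ≤ l1OpNorm !![b0, b1; p, q] * (u + v) := by
  have e : l1OpNorm !![b0, b1; p, q] = max (b0 + p) (b1 + q) := by
    simp [l1OpNorm, abs_of_nonneg, *]
  rw [e]
  nlinarith [mul_le_mul_of_nonneg_right (le_max_left (b0 + p) (b1 + q)) hu,
    mul_le_mul_of_nonneg_right (le_max_right (b0 + p) (b1 + q)) hv]

theorem functional_coefficient_AR_drift_bound
    {d : ℕ}
    -- the coefficient functions and their envelopes
    (a : Fin 2 → (Fin d → ℝ) → (Fin 2 → ℝ) → ℝ)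
    (ha : ∀ j, Measurable fun q : (Fin d → ℝ) × (Fin 2 → ℝ) => a j q.1 q.2)
    (bfun : Fin 2 → (Fin d → ℝ) → ℝ)
    (hbsup : ∀ (j : Fin 2) (x : Fin d → ℝ),
      IsLUB (Set.range fun y : Fin 2 → ℝ => |a j x y|) (bfun j x))
    -- the noise density, with finite first absolute moment
    (f : ℝ → ℝ) (hf : Measurable f) (hf0 : ∀ u, 0 ≤ f u)
    (hfdens : ∫⁻ u, ENNReal.ofReal (f u) = 1)
    (hmom : Integrable (fun u => |u| * f u) volume)
    -- the Markov kernel of the model: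
    -- P_x((y₁,y₂), A) = ∫ 1_A(g(x,y₁,y₂) + u, y₁) f(u) du
    (P : Kernel ((Fin d → ℝ) × (ℝ × ℝ)) (ℝ × ℝ)) [IsMarkovKernel P]
    (hP : ∀ (x : Fin d → ℝ) (y : ℝ × ℝ) (A : Set (ℝ × ℝ)), MeasurableSet A →
      P (x, y) A = ∫⁻ u, A.indicator (fun _ => (1 : ℝ≥0∞))
        (a 0 x ![y.1, y.2] * y.1 + a 1 x ![y.1, y.2] * y.2 + u, y.1) *
          ENNReal.ofReal (f u)) :
    -- the k-step Foster–Lyapunov drift bound with V(y₁,y₂) = |y₁| + |y₂|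
    ∀ k : ℕ, 1 ≤ k → ∀ xs : ℕ → (Fin d → ℝ), ∀ y : ℝ × ℝ,
      ∫⁻ z, ENNReal.ofReal (|z.1| + |z.2|)
          ∂(iterFrom P ((List.range k).map xs) (Measure.dirac y)) ≤
        ENNReal.ofReal
            (l1OpNorm (((List.range k).map fun i => compMat2 bfun (xs (k - 1 - i))).prod)) *
          ENNReal.ofReal (|y.1| + |y.2|) +
        ENNReal.ofReal ((∫ u, |u| * f u) *
          (1 + ∑ m ∈ Finset.Icc 1 (k - 1),
            ∏ l ∈ Finset.range m, l1OpNorm (compMat2 bfun (xs (k - 1 - l))))) := by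
  have hb : ∀ j x, 0 ≤ bfun j x := fun j x =>
    (abs_nonneg _).trans ((hbsup j x).1 ⟨0, rfl⟩)
  have hab : ∀ j x y, |a j x y| ≤ bfun j x := fun j x y => (hbsup j x).1 ⟨y, rfl⟩
  set C : ℝ := ∫ u, |u| * f u with hC
  have hC0 : 0 ≤ C := integral_nonneg fun u => mul_nonneg (abs_nonneg _) (hf0 u)
  have hCl : ∫⁻ u, ENNReal.ofReal (|u| * f u) = ENNReal.ofReal C :=
    (ofReal_integral_eq_lintegral_ofReal hmom
      (Eventually.of_forall fun u => mul_nonneg (abs_nonneg _) (hf0 u))).symm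
  have m1 : Measurable (fun z : ℝ × ℝ => ENNReal.ofReal |z.1|) := by fun_prop
  have m2 : Measurable (fun z : ℝ × ℝ => ENNReal.ofReal |z.2|) := by fun_prop
  -- one-step bounds
  have s1 : ∀ (x : Fin d → ℝ) (y : ℝ × ℝ), ∫⁻ z, ENNReal.ofReal |z.1| ∂(P (x, y)) ≤
      (ENNReal.ofReal (bfun 0 x) * ENNReal.ofReal |y.1| +
        ENNReal.ofReal (bfun 1 x) * ENNReal.ofReal |y.2|) + ENNReal.ofReal C := by
    intro x y
    rw [lintegral_P_eq f hf P x y _ (hP x y) _ m1]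
    set g := a 0 x ![y.1, y.2] * y.1 + a 1 x ![y.1, y.2] * y.2 with hg
    have hgb : |g| ≤ bfun 0 x * |y.1| + bfun 1 x * |y.2| := by
      refine (abs_add_le _ _).trans ?_
      rw [abs_mul, abs_mul]
      gcongr <;> exact hab _ _ _
    calc ∫⁻ u, ENNReal.ofReal (f u) * ENNReal.ofReal |g + u|
        ≤ ∫⁻ u, (ENNReal.ofReal |g| * ENNReal.ofReal (f u) + ENNReal.ofReal (|u| * f u)) := by
          refine lintegral_mono fun u => ?_
          rw [← ENNReal.ofReal_mul (hf0 u), ← ENNReal.ofReal_mul (abs_nonneg _),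
            ← ENNReal.ofReal_add (mul_nonneg (abs_nonneg _) (hf0 u))
              (mul_nonneg (abs_nonneg _) (hf0 u))]
          apply ENNReal.ofReal_le_ofReal
          nlinarith [mul_le_mul_of_nonneg_left (abs_add_le g u) (hf0 u)]
      _ = ENNReal.ofReal |g| + ENNReal.ofReal C := by
          rw [lintegral_add_left (by fun_prop), lintegral_const_mul _ (by fun_prop), hfdens,
            hCl, mul_one]
      _ ≤ _ := by
          gcongr
          rw [← ENNReal.ofReal_mul (hb _ _), ← ENNReal.ofReal_mul (hb _ _),
            ← ENNReal.ofReal_add (mul_nonneg (hb _ _) (abs_nonneg _))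
              (mul_nonneg (hb _ _) (abs_nonneg _))]
          exact ENNReal.ofReal_le_ofReal hgb
  have s2 : ∀ (x : Fin d → ℝ) (y : ℝ × ℝ), ∫⁻ z, ENNReal.ofReal |z.2| ∂(P (x, y)) =
      ENNReal.ofReal |y.1| := by
    intro x y
    rw [lintegral_P_eq f hf P x y _ (hP x y) _ m2]
    simp only
    rw [lintegral_mul_const _ (by fun_prop), hfdens, one_mul]
  have key : ∀ (xs : ℕ → (Fin d → ℝ)) (y : ℝ × ℝ) (k : ℕ),
      ∃ (M : Matrix (Fin 2) (Fin 2) ℝ) (t0 t1 : ℝ),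
        ((List.range k).map fun i => compMat2 bfun (xs (k - 1 - i))).prod = M ∧
        (∀ i j, 0 ≤ M i j) ∧ 0 ≤ t0 ∧ 0 ≤ t1 ∧
        t0 + t1 ≤ C * ∑ m ∈ Finset.range k,
            ∏ l ∈ Finset.range m, l1OpNorm (compMat2 bfun (xs (k - 1 - l))) ∧
        iterFrom P ((List.range k).map xs) (Measure.dirac y) Set.univ = 1 ∧
        ∫⁻ z, ENNReal.ofReal |z.1| ∂(iterFrom P ((List.range k).map xs) (Measure.dirac y)) ≤
          ENNReal.ofReal (M 0 0 * |y.1| + M 0 1 * |y.2| + t0) ∧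
        ∫⁻ z, ENNReal.ofReal |z.2| ∂(iterFrom P ((List.range k).map xs) (Measure.dirac y)) ≤
          ENNReal.ofReal (M 1 0 * |y.1| + M 1 1 * |y.2| + t1) := by
    intro xs y k
    induction k with
    | zero =>
      refine ⟨1, 0, 0, by simp, ?_, le_rfl, le_rfl, by simp, by simp [iterFrom], ?_, ?_⟩
      · intro i j
        fin_cases i <;> fin_cases j <;> simp
      · simp [iterFrom, lintegral_dirac' _ m1]
      · simp [iterFrom, lintegral_dirac' _ m2]
    | succ k ih =>
      obtain ⟨M, t0, t1, hM, hM0, ht0, ht1, ht, hmass, i1, i2⟩ := ih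
      have hy1 := abs_nonneg y.1
      have hy2 := abs_nonneg y.2
      set μ := iterFrom P ((List.range k).map xs) (Measure.dirac y) with hμ
      have hit : iterFrom P ((List.range (k + 1)).map xs) (Measure.dirac y) =
          stepMeas P (xs k) μ := by
        rw [List.range_succ, List.map_append, List.map_singleton, iterFrom_append_single]
      have b0 := hb 0 (xs k)
      have b1 := hb 1 (xs k)
      refine ⟨compMat2 bfun (xs k) * M, bfun 0 (xs k) * t0 + bfun 1 (xs k) * t1 + C, t0,
        ?_, ?_, by positivity, ht0, ?_, ?_, ?_, ?_⟩
      · rw [List.range_succ_eq_map, List.map_cons, List.prod_cons, ← hM, List.map_map]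
        simp [Function.comp_def, Nat.sub_sub, Nat.add_comm]
      · intro i j
        have h0 := hM0 0 j
        have h1 := hM0 1 j
        rw [Matrix.mul_apply, Fin.sum_univ_two]
        fin_cases i
        · simpa [compMat2] using add_nonneg (mul_nonneg b0 h0) (mul_nonneg b1 h1)
        · simpa [compMat2] using h0
      · have hs : ∑ m ∈ Finset.range (k + 1),
            ∏ l ∈ Finset.range m, l1OpNorm (compMat2 bfun (xs (k + 1 - 1 - l))) =
            l1OpNorm (compMat2 bfun (xs k)) * (∑ m ∈ Finset.range k,
            ∏ l ∈ Finset.range m, l1OpNorm (compMat2 bfun (xs (k - 1 - l)))) + 1 := by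
          rw [Finset.sum_range_succ', Finset.mul_sum]
          congr 1
          refine Finset.sum_congr rfl fun m _ => ?_
          rw [Finset.prod_range_succ', mul_comm]
          simp [Nat.sub_sub, Nat.add_comm]
        rw [hs]
        have hl := l1_ineq 1 0 t0 t1 _ _ b0 b1 ht0 ht1 zero_le_one le_rfl
        have hn : 0 ≤ l1OpNorm (compMat2 bfun (xs k)) :=
          le_max_of_le_left (by positivity)
        have := mul_le_mul_of_nonneg_left ht hn
        change _ ≤ l1OpNorm (compMat2 bfun (xs k)) * _ at hl
        nlinarith
      · rw [hit, ← lintegral_one, lintegral_stepMeas _ _ _ (fun _ => 1) measurable_const]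
        simp [hmass]
      · rw [hit, lintegral_stepMeas _ _ _ _ m1]
        refine (lintegral_mono fun y => s1 (xs k) y).trans ?_
        rw [lintegral_add_right _ measurable_const, lintegral_const, hmass, mul_one,
          lintegral_add_left (by fun_prop), lintegral_const_mul _ m1,
          lintegral_const_mul _ m2]
        have p00 := hM0 0 0
        have p01 := hM0 0 1
        have p10 := hM0 1 0
        have p11 := hM0 1 1
        calc _ ≤ ENNReal.ofReal (bfun 0 (xs k)) *
              ENNReal.ofReal (M 0 0 * |y.1| + M 0 1 * |y.2| + t0) +
              ENNReal.ofReal (bfun 1 (xs k)) *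
              ENNReal.ofReal (M 1 0 * |y.1| + M 1 1 * |y.2| + t1) + ENNReal.ofReal C := by
              gcongr
          _ = _ := by
              rw [← ENNReal.ofReal_mul b0, ← ENNReal.ofReal_mul b1,
                ← ENNReal.ofReal_add (by positivity) (by positivity),
                ← ENNReal.ofReal_add (by positivity) hC0]
              congr 1
              simp [compMat2, Matrix.mul_apply, Fin.sum_univ_two]
              ring
      · rw [hit, lintegral_stepMeas _ _ _ _ m2]
        simp only [s2]
        refine i1.trans (le_of_eq ?_)
        congr 1
        simp [compMat2, Matrix.mul_apply, Fin.sum_univ_two]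
  intro k hk xs y
  obtain ⟨M, t0, t1, hM, hM0, ht0, ht1, ht, hmass, i1, i2⟩ := key xs y k
  have hy1 := abs_nonneg y.1
  have hy2 := abs_nonneg y.2
  have p00 := hM0 0 0
  have p01 := hM0 0 1
  have p10 := hM0 1 0
  have p11 := hM0 1 1
  have hsum : ∑ m ∈ Finset.range k,
      ∏ l ∈ Finset.range m, l1OpNorm (compMat2 bfun (xs (k - 1 - l))) =
      1 + ∑ m ∈ Finset.Icc 1 (k - 1),
            ∏ l ∈ Finset.range m, l1OpNorm (compMat2 bfun (xs (k - 1 - l))) := by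
    have e : Finset.range k = insert 0 (Finset.Icc 1 (k - 1)) := by
      ext m
      simp only [Finset.mem_range, Finset.mem_insert, Finset.mem_Icc]
      omega
    rw [e, Finset.sum_insert (by simp)]
    simp
  rw [hM, ← hsum]
  have hl := l1_ineq (M 1 0) (M 1 1) |y.1| |y.2| _ _ p00 p01 hy1 hy2 p10 p11
  rw [← Matrix.eta_fin_two M] at hl
  have hn : 0 ≤ l1OpNorm M := le_max_of_le_left (by positivity)
  have hsp : ∀ z : ℝ × ℝ, ENNReal.ofReal (|z.1| + |z.2|) =
      ENNReal.ofReal |z.1| + ENNReal.ofReal |z.2| := fun z =>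
    ENNReal.ofReal_add (abs_nonneg _) (abs_nonneg _)
  rw [lintegral_congr hsp, lintegral_add_left m1, ← ENNReal.ofReal_mul hn,
    ← ENNReal.ofReal_add (by positivity) ((add_nonneg ht0 ht1).trans ht)]
  refine (add_le_add i1 i2).trans ?_
  rw [← ENNReal.ofReal_add (by positivity) (by positivity)]
  apply ENNReal.ofReal_le_ofReal
  linarith

end
end
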